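/- arXiv:2505.23384 — 2 statements merged into one kernel-verified Lean document; each statement's English description precedes it below -/
import Mathlib

section
/- For every constant δ > 0 there exists a constant C > 0 such that the following holds. For every sufficiently large integer d, there exist infinitely many integers n for which there exists an (n,d,λ)-graph G with λ/d ≤ δ satisfying μ(G) ≤ exp(C·n·log d / d), where μ(G) is the number of pairwise non-isomorphic induced subgraphs of G. -/
open Finset

/-- The adjacency matrix of `G` over `ℝ` is Hermitian. -/
noncomputable def SimpleGraph.adjHermitian {n : ℕ} (G : SimpleGraph (Fin n)) :
    letI := Classical.decRel G.Adj
    ((G.adjMatrix ℝ).IsHermitian) := by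
  letI := Classical.decRel G.Adj
  rw [Matrix.IsHermitian, Matrix.conjTranspose_eq_transpose_of_trivial]
  exact G.isSymm_adjMatrix

/-- `G` is an `(n,d,λ)`-graph: a `d`-regular graph on `n` vertices all of whose
adjacency-matrix eigenvalues, except one eigenvalue equal to `d`, have absolute
value at most `lam`. -/
noncomputable def IsNDLGraph (n d : ℕ) (lam : ℝ) (G : SimpleGraph (Fin n)) : Prop :=
  letI := Classical.decRel G.Adj
  G.IsRegularOfDegree d ∧
    ∃ i₀ : Fin n, (G.adjHermitian.eigenvalues i₀ = d ∧
      ∀ i : Fin n, i ≠ i₀ → |G.adjHermitian.eigenvalues i| ≤ lam)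

/-- `G` has an induced path on `k` vertices. -/
def HasInducedPath {V : Type*} (G : SimpleGraph V) (k : ℕ) : Prop :=
  ∃ f : Fin k → V, Function.Injective f ∧
    ∀ i j : Fin k, G.Adj (f i) (f j) ↔ ((i : ℕ) + 1 = (j : ℕ) ∨ (j : ℕ) + 1 = (i : ℕ))

/-- `G` has an induced cycle of length `k`. -/
def HasInducedCycle {V : Type*} (G : SimpleGraph V) (k : ℕ) : Prop :=
  3 ≤ k ∧ ∃ f : ZMod k → V, Function.Injective f ∧
    ∀ i j : ZMod k, G.Adj (f i) (f j) ↔ (i - j = 1 ∨ j - i = 1)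

/-- The adjacency operator of a graph acting on real functions on its vertices. -/
noncomputable def adjOp {V : Type*} [Fintype V] (G : SimpleGraph V) (f : V → ℝ) (v : V) : ℝ :=
  letI := Classical.decRel G.Adj
  ∑ u, if G.Adj v u then f u else 0

/-- The adjacency operator of `G` has norm at most `lam` on functions with vanishing sum. -/
def SpectralBound {V : Type*} [Fintype V] (G : SimpleGraph V) (lam : ℝ) : Prop :=
  ∀ f : V → ℝ, ∑ v, f v = 0 → ∑ v, adjOp G f v ^ 2 ≤ lam ^ 2 * ∑ v, f v ^ 2

section Eigenvalues

theorem adjOp_eq_mulVec {V : Type*} [Fintype V] (G : SimpleGraph V) (f : V → ℝ) :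
    letI := Classical.decRel G.Adj
    adjOp G f = (G.adjMatrix ℝ).mulVec f := by
  classical
  funext v
  simp [adjOp, Matrix.mulVec, dotProduct, SimpleGraph.adjMatrix_apply]

theorem adjOp_eigenvectorBasis {n : ℕ} (G : SimpleGraph (Fin n)) (i v : Fin n) :
    adjOp G (G.adjHermitian.eigenvectorBasis i) v =
      G.adjHermitian.eigenvalues i * G.adjHermitian.eigenvectorBasis i v := by
  have h := G.adjHermitian.mulVec_eigenvectorBasis i
  rw [← adjOp_eq_mulVec] at h
  have := congrFun h v
  simpa using this

theorem adjOp_symm {V : Type*} [Fintype V] (G : SimpleGraph V) (f g : V → ℝ) :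
    ∑ v, adjOp G f v * g v = ∑ v, f v * adjOp G g v := by
  classical
  simp only [adjOp, Finset.sum_mul, Finset.mul_sum]
  rw [Finset.sum_comm]
  refine Finset.sum_congr rfl fun u _ => Finset.sum_congr rfl fun v _ => ?_
  by_cases h : G.Adj u v
  · simp [h, h.symm]
  · simp [h, mt SimpleGraph.Adj.symm h]

theorem isNDLGraph_of_spectralBound {n d : ℕ} (hn : 0 < n) {lam : ℝ} (hlam : 0 ≤ lam)
    (G : SimpleGraph (Fin n)) (hreg : ∀ v, adjOp G (fun _ => 1) v = d)
    (hspec : SpectralBound G lam) : IsNDLGraph n d lam G := by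
  classical
  refine ⟨fun v => ?_, ?_⟩
  · have h := hreg v
    simp only [adjOp, Finset.sum_boole] at h
    rw [← SimpleGraph.card_neighborFinset_eq_degree]
    rw [SimpleGraph.neighborFinset_eq_filter]
    convert Nat.cast_injective h
  · set e := G.adjHermitian.eigenvectorBasis with he
    set m := G.adjHermitian.eigenvalues with hm
    have hop : ∀ i v, adjOp G (e i) v = m i * e i v := adjOp_eigenvectorBasis G
    have hnorm : ∀ i, ∑ v, e i v ^ 2 = 1 := by
      intro i
      have := e.orthonormal.1 i
      rw [EuclideanSpace.norm_eq, Real.sqrt_eq_one] at this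
      simpa using this
    have horth : ∀ i j, i ≠ j → ∑ v, e i v * e j v = 0 := by
      intro i j hij
      have : inner ℝ (e i) (e j) = 0 := e.orthonormal.2 hij
      rw [PiLp.inner_apply] at this
      simpa [mul_comm] using this
    have key : ∀ i, m i * ∑ v, e i v = d * ∑ v, e i v := by
      intro i
      have h := adjOp_symm G (e i) (fun _ => 1)
      simp only [hop, hreg, mul_one] at h
      rw [Finset.mul_sum, h, Finset.mul_sum]
      exact Finset.sum_congr rfl fun v _ => mul_comm _ _
    have hbound : ∀ (f : Fin n → ℝ) (a : ℝ), ∑ v, f v = 0 → (∀ v, adjOp G f v = a * f v) →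
        0 < ∑ v, f v ^ 2 → |a| ≤ lam := by
      intro f a h0 ha hpos
      have h := hspec f h0
      simp only [ha, mul_pow] at h
      rw [← Finset.mul_sum] at h
      exact abs_le_of_sq_le_sq (le_of_mul_le_mul_right h hpos) hlam
    obtain ⟨i₀, hi₀⟩ : ∃ i, ∑ v, e i v ≠ 0 := by
      by_contra! hcon
      have : (WithLp.toLp 2 (fun _ => 1) : EuclideanSpace ℝ (Fin n)) = 0 := by
        refine e.repr.injective (PiLp.ext fun i => ?_)
        rw [e.repr_apply_apply, PiLp.inner_apply]
        simpa using hcon i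
      have := congrFun (congrArg WithLp.ofLp this) ⟨0, hn⟩
      simp at this
    refine ⟨i₀, mul_right_cancel₀ hi₀ (key i₀), fun i hi => ?_⟩
    have hm0 : m i₀ = d := mul_right_cancel₀ hi₀ (key i₀)
    by_cases hz : ∑ v, e i v = 0
    · exact hbound (e i) _ hz (hop i) (by rw [hnorm]; exact one_pos)
    · have hmi : m i = d := mul_right_cancel₀ hz (key i)
      set s := ∑ v, e i₀ v
      set t := ∑ v, e i v
      refine hbound (fun v => s * e i v - t * e i₀ v) _ ?_ ?_ ?_
      · rw [Finset.sum_sub_distrib, ← Finset.mul_sum, ← Finset.mul_sum]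
        ring
      · intro v
        have : adjOp G (fun v => s * e i v - t * e i₀ v) v =
            s * adjOp G (e i) v - t * adjOp G (e i₀) v := by
          simp only [adjOp, Finset.mul_sum, ← Finset.sum_sub_distrib]
          refine Finset.sum_congr rfl fun u _ => ?_
          split_ifs <;> simp
        rw [this, hop, hop, hm0, hmi]
        ring
      · have : ∑ v, (s * e i v - t * e i₀ v) ^ 2 = s ^ 2 + t ^ 2 := by
          have : ∀ v, (s * e i v - t * e i₀ v) ^ 2 =
            s ^ 2 * e i v ^ 2 + t ^ 2 * e i₀ v ^ 2 - 2 * s * t * (e i v * e i₀ v) := fun v => by ring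
          simp only [this]
          rw [Finset.sum_sub_distrib, Finset.sum_add_distrib, ← Finset.mul_sum, ← Finset.mul_sum,
            ← Finset.mul_sum, hnorm, hnorm, horth i i₀ hi]
          ring
        rw [this]
        positivity

end Eigenvalues

section Fourier

open Complex

/-- The discrete Fourier transform on `(ZMod N)²`. -/
noncomputable def dft₂ {N : ℕ} [NeZero N] (f : ZMod N × ZMod N → ℝ) (z : ZMod N × ZMod N) : ℂ :=
  ∑ x : ZMod N × ZMod N, (f x : ℂ) * ZMod.stdAddChar (z.1 * x.1 + z.2 * x.2)

variable {N : ℕ} [NeZero N]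

theorem sum_stdAddChar_pair (x : ZMod N × ZMod N) :
    ∑ z : ZMod N × ZMod N, (ZMod.stdAddChar (z.1 * x.1 + z.2 * x.2) : ℂ) =
      if x = 0 then (N : ℂ) ^ 2 else 0 := by
  have h : ∀ a : ZMod N, ∑ z : ZMod N, (ZMod.stdAddChar (z * a) : ℂ) =
      if a = 0 then (N : ℂ) else 0 := fun a => by
    rw [AddChar.sum_mulShift a (ZMod.isPrimitive_stdAddChar N), ZMod.card]
    split_ifs <;> simp
  rw [Fintype.sum_prod_type]
  simp only [AddChar.map_add_eq_mul, ← Finset.mul_sum, ← Finset.sum_mul, h]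
  by_cases h1 : x.1 = 0 <;> by_cases h2 : x.2 = 0 <;> simp [h1, h2, Prod.ext_iff, sq]

theorem dft₂_zero (f : ZMod N × ZMod N → ℝ) : dft₂ f 0 = ((∑ x, f x : ℝ) : ℂ) := by
  simp [dft₂]

theorem dft₂_sub (f g : ZMod N × ZMod N → ℝ) (z : ZMod N × ZMod N) :
    dft₂ (fun x => f x - g x) z = dft₂ f z - dft₂ g z := by
  simp [dft₂, sub_mul, Finset.sum_sub_distrib]

theorem sum_norm_dft₂_sq (f : ZMod N × ZMod N → ℝ) :
    ∑ z, ‖dft₂ f z‖ ^ 2 = (N : ℝ) ^ 2 * ∑ x, f x ^ 2 := by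
  have h : ∀ z, ((‖dft₂ f z‖ ^ 2 : ℝ) : ℂ) = ∑ x, ∑ y, (f x * f y : ℂ) *
      ZMod.stdAddChar (z.1 * (x - y).1 + z.2 * (x - y).2) := by
    intro z
    rw [ofReal_pow, ← Complex.mul_conj', dft₂, map_sum, Finset.sum_mul_sum]
    refine Finset.sum_congr rfl fun x _ => Finset.sum_congr rfl fun y _ => ?_
    rw [map_mul, conj_ofReal, ← AddChar.map_neg_eq_conj, mul_mul_mul_comm,
      ← AddChar.map_add_eq_mul]
    congr 2
    simp only [Prod.fst_sub, Prod.snd_sub]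
    ring
  have : ((∑ z, ‖dft₂ f z‖ ^ 2 : ℝ) : ℂ) = (((N : ℝ) ^ 2 * ∑ x, f x ^ 2 : ℝ) : ℂ) := by
    rw [ofReal_sum]
    simp only [h]
    rw [Finset.sum_comm]
    push_cast
    rw [Finset.mul_sum]
    refine Finset.sum_congr rfl fun x _ => ?_
    rw [Finset.sum_comm]
    simp only [← Finset.mul_sum, sum_stdAddChar_pair, sub_eq_zero, mul_ite, mul_zero,
      Finset.sum_ite_eq, Finset.mem_univ, if_true]
    ring
  exact_mod_cast this

/-- The shear `(x, y) ↦ (x, y + 2 x)`. -/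
def shearSnd (N : ℕ) : Equiv.Perm (ZMod N × ZMod N) where
  toFun x := (x.1, x.2 + 2 * x.1)
  invFun x := (x.1, x.2 - 2 * x.1)
  left_inv x := by simp
  right_inv x := by simp

/-- The shear `(x, y) ↦ (x + 2 y, y)`. -/
def shearFst (N : ℕ) : Equiv.Perm (ZMod N × ZMod N) where
  toFun x := (x.1 + 2 * x.2, x.2)
  invFun x := (x.1 - 2 * x.2, x.2)
  left_inv x := by simp
  right_inv x := by simp

theorem dft₂_shearSnd (f : ZMod N × ZMod N → ℝ) (z : ZMod N × ZMod N) :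
    dft₂ (fun x => f (shearSnd N x)) z = dft₂ f ((shearFst N).symm z) := by
  rw [dft₂, dft₂, ← Equiv.sum_comp (shearSnd N) (fun x => (f x : ℂ) * _)]
  refine Finset.sum_congr rfl fun x _ => ?_
  congr 2
  simp only [shearSnd, shearFst, Equiv.coe_fn_mk, Equiv.coe_fn_symm_mk]
  ring

theorem dft₂_shearFst (f : ZMod N × ZMod N → ℝ) (z : ZMod N × ZMod N) :
    dft₂ (fun x => f (shearFst N x)) z = dft₂ f ((shearSnd N).symm z) := by
  rw [dft₂, dft₂, ← Equiv.sum_comp (shearFst N) (fun x => (f x : ℂ) * _)]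
  refine Finset.sum_congr rfl fun x _ => ?_
  congr 2
  simp only [shearSnd, shearFst, Equiv.coe_fn_mk, Equiv.coe_fn_symm_mk]
  ring

theorem dft₂_translate (f : ZMod N × ZMod N → ℝ) (a z : ZMod N × ZMod N) :
    dft₂ (fun x => f (x + a)) z = ZMod.stdAddChar (-(z.1 * a.1 + z.2 * a.2)) * dft₂ f z := by
  rw [dft₂, dft₂, ← Equiv.sum_comp (Equiv.addRight a) (fun x => (f x : ℂ) * _), Finset.mul_sum]
  refine Finset.sum_congr rfl fun x _ => ?_
  simp only [Equiv.coe_addRight, Prod.fst_add, Prod.snd_add]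
  rw [show z.1 * x.1 + z.2 * x.2 = -(z.1 * a.1 + z.2 * a.2) +
    (z.1 * (x.1 + a.1) + z.2 * (x.2 + a.2)) by ring, AddChar.map_add_eq_mul]
  ring

theorem half_le_norm_stdAddChar_sub_one_sq (a : ZMod N) (ha : N ≤ 8 * a.valMinAbs.natAbs) :
    1 / 2 ≤ ‖(ZMod.stdAddChar (-a) : ℂ) - 1‖ ^ 2 := by
  have hN : (0 : ℝ) < N := by exact_mod_cast NeZero.pos N
  set k : ℤ := a.valMinAbs with hk
  have hka : -a = ((-k : ℤ) : ZMod N) := by simp [hk]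
  set θ : ℝ := 2 * Real.pi * |(k : ℝ)| / N with hθ
  have hexp : (ZMod.stdAddChar (-a) : ℂ) = Complex.exp ((2 * Real.pi * (-k) / N : ℝ) * I) := by
    rw [hka, ZMod.stdAddChar_coe]
    congr 1
    push_cast
    ring
  have hcos : Real.cos (2 * Real.pi * (-k) / N) = Real.cos θ := by
    rw [← Real.cos_abs, hθ]
    congr 1
    rw [abs_div, abs_mul, abs_neg, abs_of_pos hN, abs_of_pos Real.two_pi_pos]
  have h1 : ‖(ZMod.stdAddChar (-a) : ℂ) - 1‖ ^ 2 = 2 - 2 * Real.cos θ := by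
    rw [hexp, ← hcos, ← Complex.normSq_eq_norm_sq, Complex.normSq_apply]
    simp only [sub_re, sub_im, exp_ofReal_mul_I_re, exp_ofReal_mul_I_im, one_re, one_im]
    nlinarith [Real.sin_sq_add_cos_sq (2 * Real.pi * (-k) / N)]
  have hlow : Real.pi / 4 ≤ θ := by
    have : (N : ℝ) ≤ 8 * |(k : ℝ)| := by
      rw [← Int.cast_abs, ← Nat.cast_natAbs]
      exact_mod_cast ha
    rw [hθ, le_div_iff₀ hN]
    nlinarith [Real.pi_pos]
  have hup : θ ≤ Real.pi := by
    have : 2 * |(k : ℝ)| ≤ N := by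
      have h2 := ZMod.valMinAbs_mem_Ioc a
      have : 2 * |k| ≤ N := by
        rw [← hk] at h2
        obtain ⟨h3, h4⟩ := h2
        rcases abs_cases k with h | h <;> omega
      exact_mod_cast this
    rw [hθ, div_le_iff₀ hN]
    nlinarith [Real.pi_pos]
  have hc : Real.cos θ ≤ Real.sqrt 2 / 2 := by
    rw [← Real.cos_pi_div_four]
    exact Real.cos_le_cos_of_nonneg_of_le_pi (by positivity) hup hlow
  have hs : Real.sqrt 2 ≤ 3 / 2 := by
    rw [Real.sqrt_le_left (by norm_num)]
    norm_num
  rw [h1]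
  linarith

end Fourier

section SpectralGap

variable {N : ℕ} [NeZero N]

theorem valMinAbs_add_two_mul {x y : ZMod N} (hx : 8 * x.valMinAbs.natAbs < N)
    (hy : 8 * y.valMinAbs.natAbs < N) :
    (y + 2 * x).valMinAbs = y.valMinAbs + 2 * x.valMinAbs := by
  rw [ZMod.valMinAbs_spec]
  refine ⟨by push_cast; simp, ?_, ?_⟩ <;> omega

theorem valMinAbs_sub_two_mul {x y : ZMod N} (hx : 8 * x.valMinAbs.natAbs < N)
    (hy : 8 * y.valMinAbs.natAbs < N) :
    (y - 2 * x).valMinAbs = y.valMinAbs - 2 * x.valMinAbs := by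
  rw [ZMod.valMinAbs_spec]
  refine ⟨by push_cast; simp, ?_, ?_⟩ <;> omega

theorem sum_sq_steep_ge {g : ZMod N × ZMod N → ℝ} {η : ℝ} (h0 : g 0 = 0)
    (hshear : ∑ z, (g (shearSnd N z) - g z) ^ 2 ≤ η)
    (h1 : ∑ z with N ≤ 8 * z.1.valMinAbs.natAbs, g z ^ 2 ≤ 2 * η)
    (h2 : ∑ z with N ≤ 8 * z.2.valMinAbs.natAbs, g z ^ 2 ≤ 2 * η) :
    3 / 2 * ∑ z with z.2.valMinAbs.natAbs ≤ z.1.valMinAbs.natAbs, g z ^ 2 - 12 * η ≤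
      ∑ z with z.1.valMinAbs.natAbs ≤ z.2.valMinAbs.natAbs, g z ^ 2 := by
  set A : Finset (ZMod N × ZMod N) :=
    {z | z.2.valMinAbs.natAbs ≤ z.1.valMinAbs.natAbs} with hA
  set B : Finset (ZMod N × ZMod N) :=
    {z | z.1.valMinAbs.natAbs ≤ z.2.valMinAbs.natAbs} with hB
  set X : Finset (ZMod N × ZMod N) := {z | N ≤ 8 * z.1.valMinAbs.natAbs} with hX
  set Y : Finset (ZMod N × ZMod N) := {z | N ≤ 8 * z.2.valMinAbs.natAbs} with hY
  set A' : Finset (ZMod N × ZMod N) :=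
    {z | 8 * z.1.valMinAbs.natAbs < N ∧ 8 * z.2.valMinAbs.natAbs < N ∧
      z.2.valMinAbs.natAbs ≤ z.1.valMinAbs.natAbs ∧ z.1.valMinAbs ≠ 0} with hA'
  have hAA' : ∑ z ∈ A, g z ^ 2 ≤ ∑ z ∈ A', g z ^ 2 + 4 * η := by
    have hsub : A ⊆ insert 0 (A' ∪ (X ∪ Y)) := by
      intro z hz
      simp only [hA, hA', hX, hY, Finset.mem_insert, Finset.mem_union, Finset.mem_filter,
        Finset.mem_univ, true_and] at hz ⊢
      by_cases hz0 : z.1.valMinAbs = 0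
      · left
        have hz2 : z.2.valMinAbs = 0 := by omega
        rw [ZMod.valMinAbs_eq_zero] at hz0 hz2
        exact Prod.ext hz0 hz2
      · right
        omega
    have hle : ∀ s t : Finset (ZMod N × ZMod N),
        ∑ z ∈ s ∪ t, g z ^ 2 ≤ ∑ z ∈ s, g z ^ 2 + ∑ z ∈ t, g z ^ 2 := fun s t => by
      rw [← Finset.sum_union_inter]
      exact le_add_of_nonneg_right (Finset.sum_nonneg fun _ _ => sq_nonneg _)
    have h3 := Finset.sum_le_sum_of_subset_of_nonneg hsub (f := fun z => g z ^ 2)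
      fun _ _ _ => sq_nonneg _
    rw [Finset.sum_insert_of_eq_zero_if_notMem (fun _ => by simp [h0])] at h3
    linarith [hle A' (X ∪ Y), hle X Y]
  have hpt : ∀ a b : ℝ, 3 / 4 * a ^ 2 - 3 * (b - a) ^ 2 ≤ b ^ 2 := fun a b => by
    nlinarith [sq_nonneg (4 * b - 3 * a)]
  have hmove : ∀ σ : Equiv.Perm (ZMod N × ZMod N), ∑ z, (g (σ z) - g z) ^ 2 ≤ η →
      3 / 4 * ∑ z ∈ A', g z ^ 2 - 3 * η ≤ ∑ z ∈ A'.map σ.toEmbedding, g z ^ 2 := by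
    intro σ hσ
    rw [Finset.sum_map]
    have h3 := Finset.sum_le_sum fun z (_ : z ∈ A') => hpt (g z) (g (σ z))
    rw [Finset.sum_sub_distrib, ← Finset.mul_sum, ← Finset.mul_sum] at h3
    have h4 := Finset.sum_le_sum_of_subset_of_nonneg (Finset.subset_univ A')
      (f := fun z => (g (σ z) - g z) ^ 2) fun _ _ _ => sq_nonneg _
    simp only [Equiv.coe_toEmbedding]
    linarith
  have hinv : ∑ z, (g ((shearSnd N).symm z) - g z) ^ 2 ≤ η := by
    rw [← Equiv.sum_comp (shearSnd N)]
    simpa only [Equiv.symm_apply_apply, sub_sq_comm] using hshear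
  have hdisj : Disjoint (A'.map (shearSnd N).toEmbedding)
      (A'.map (shearSnd N).symm.toEmbedding) := by
    rw [Finset.disjoint_left]
    intro w hw hw'
    obtain ⟨z, hz, rfl⟩ := Finset.mem_map.1 hw
    obtain ⟨z', hz', hzz⟩ := Finset.mem_map.1 hw'
    simp only [hA', Finset.mem_filter, Finset.mem_univ, true_and] at hz hz'
    have hpair : (z'.1, z'.2 - 2 * z'.1) = (z.1, z.2 + 2 * z.1) := hzz
    obtain ⟨e1, e2⟩ := Prod.mk.inj hpair
    have e3 := congrArg ZMod.valMinAbs e2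
    rw [valMinAbs_add_two_mul hz.1 hz.2.1, valMinAbs_sub_two_mul hz'.1 hz'.2.1, e1] at e3
    rw [e1] at hz'
    omega
  have hsubset : (A'.map (shearSnd N).toEmbedding) ∪ (A'.map (shearSnd N).symm.toEmbedding) ⊆
      B := by
    intro w hw
    simp only [hB, Finset.mem_filter, Finset.mem_univ, true_and]
    rcases Finset.mem_union.1 hw with hw | hw <;> obtain ⟨z, hz, rfl⟩ := Finset.mem_map.1 hw <;>
      simp only [hA', Finset.mem_filter, Finset.mem_univ, true_and] at hz
    · change z.1.valMinAbs.natAbs ≤ (z.2 + 2 * z.1).valMinAbs.natAbs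
      rw [valMinAbs_add_two_mul hz.1 hz.2.1]
      omega
    · change z.1.valMinAbs.natAbs ≤ (z.2 - 2 * z.1).valMinAbs.natAbs
      rw [valMinAbs_sub_two_mul hz.1 hz.2.1]
      omega
  have h3 := Finset.sum_le_sum_of_subset_of_nonneg hsubset (f := fun z => g z ^ 2)
    fun _ _ _ => sq_nonneg _
  rw [Finset.sum_union hdisj] at h3
  linarith [hmove _ hshear, hmove _ hinv]

theorem sum_sq_le_of_shear {g : ZMod N × ZMod N → ℝ} {η : ℝ} (h0 : g 0 = 0)
    (hfst : ∑ z, (g (shearFst N z) - g z) ^ 2 ≤ η)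
    (hsnd : ∑ z, (g (shearSnd N z) - g z) ^ 2 ≤ η)
    (h1 : ∑ z with N ≤ 8 * z.1.valMinAbs.natAbs, g z ^ 2 ≤ 2 * η)
    (h2 : ∑ z with N ≤ 8 * z.2.valMinAbs.natAbs, g z ^ 2 ≤ 2 * η) :
    ∑ z, g z ^ 2 ≤ 48 * η := by
  have hswap : ∀ (p : ZMod N × ZMod N → Prop) [DecidablePred p],
      ∑ z with p z, g z.swap ^ 2 = ∑ z with p z.swap, g z ^ 2 := by
    intro p _
    rw [Finset.sum_filter, Finset.sum_filter, ← Equiv.sum_comp (Equiv.prodComm _ _)]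
    simp
  have hA := sum_sq_steep_ge h0 hsnd h1 h2
  have hB := sum_sq_steep_ge (g := fun z => g z.swap) (η := η) (by simpa using h0)
    (by rw [← Equiv.sum_comp (Equiv.prodComm _ _)]; exact hfst)
    (by rw [hswap]; exact h2) (by rw [hswap]; exact h1)
  rw [hswap, hswap] at hB
  simp only [Prod.fst_swap, Prod.snd_swap] at hB
  have hcover : ∑ z, g z ^ 2 ≤ ∑ z with z.2.valMinAbs.natAbs ≤ z.1.valMinAbs.natAbs, g z ^ 2 +
      ∑ z with z.1.valMinAbs.natAbs ≤ z.2.valMinAbs.natAbs, g z ^ 2 := by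
    rw [Finset.sum_filter, Finset.sum_filter, ← Finset.sum_add_distrib]
    refine Finset.sum_le_sum fun z _ => ?_
    rcases le_total z.1.valMinAbs.natAbs z.2.valMinAbs.natAbs with h | h
    · rw [if_pos h]
      split_ifs <;> nlinarith [sq_nonneg (g z)]
    · rw [if_pos h]
      split_ifs <;> nlinarith [sq_nonneg (g z)]
  linarith

/-- The identity, two shears and two translations of `(ZMod N)²`. -/
def affineGenerators (N : ℕ) : Fin 5 → Equiv.Perm (ZMod N × ZMod N) :=
  ![1, shearFst N, shearSnd N, Equiv.addRight (1, 0), Equiv.addRight (0, 1)]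

theorem sum_sq_le_sum_sub_sq (f : ZMod N × ZMod N → ℝ) (hf : ∑ x, f x = 0) :
    ∑ x, f x ^ 2 ≤ 48 * ∑ s, ∑ x, (f (affineGenerators N s x) - f x) ^ 2 := by
  have hN : (0 : ℝ) < (N : ℝ) ^ 2 := by
    have := NeZero.pos N
    positivity
  set η : ℝ := ∑ s, ∑ x, (f (affineGenerators N s x) - f x) ^ 2 with hη
  have hs : ∀ s, ∑ x, (f (affineGenerators N s x) - f x) ^ 2 ≤ η := fun s =>
    Finset.single_le_sum (f := fun s => ∑ x, (f (affineGenerators N s x) - f x) ^ 2)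
      (fun _ _ => Finset.sum_nonneg fun _ _ => sq_nonneg _) (Finset.mem_univ s)
  have hdft : ∀ s, ∑ z, ‖dft₂ (fun x => f (affineGenerators N s x)) z - dft₂ f z‖ ^ 2 ≤
      N ^ 2 * η := fun s => by
    simp only [← dft₂_sub]
    rw [sum_norm_dft₂_sq]
    exact mul_le_mul_of_nonneg_left (hs s) hN.le
  have hnorm : ∀ a b : ℂ, (‖a‖ - ‖b‖) ^ 2 ≤ ‖a - b‖ ^ 2 := fun a b => by
    rw [sq_le_sq, abs_norm]
    exact abs_norm_sub_norm_le a b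
  have htrans : ∀ (s : Fin 5) (c : ZMod N × ZMod N → ZMod N),
      (∀ z, dft₂ (fun x => f (affineGenerators N s x)) z =
        ZMod.stdAddChar (-c z) * dft₂ f z) →
      ∑ z with N ≤ 8 * (c z).valMinAbs.natAbs, ‖dft₂ f z‖ ^ 2 ≤ 2 * (N ^ 2 * η) := by
    intro s c hc
    have h1 := hdft s
    simp only [hc, ← sub_one_mul, norm_mul, mul_pow] at h1
    have h2 : ∑ z with N ≤ 8 * (c z).valMinAbs.natAbs, 1 / 2 * ‖dft₂ f z‖ ^ 2 ≤ N ^ 2 * η := by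
      refine le_trans (Finset.sum_le_sum fun z hz => ?_) (le_trans
        (Finset.sum_le_sum_of_subset_of_nonneg (Finset.subset_univ _) fun _ _ _ => ?_) h1)
      · exact mul_le_mul_of_nonneg_right (half_le_norm_stdAddChar_sub_one_sq _
          (Finset.mem_filter.1 hz).2) (sq_nonneg _)
      · positivity
    rw [← Finset.mul_sum] at h2
    linarith
  have hmain := sum_sq_le_of_shear (g := fun z => ‖dft₂ f z‖) (η := N ^ 2 * η)
    (by simp [dft₂_zero, hf])
    (by
      rw [← Equiv.sum_comp (shearFst N).symm]
      refine le_trans (Finset.sum_le_sum fun z _ => ?_) (hdft 2)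
      rw [show affineGenerators N 2 = shearSnd N from rfl, dft₂_shearSnd, Equiv.apply_symm_apply,
        sub_sq_comm]
      exact hnorm _ _)
    (by
      rw [← Equiv.sum_comp (shearSnd N).symm]
      refine le_trans (Finset.sum_le_sum fun z _ => ?_) (hdft 1)
      rw [show affineGenerators N 1 = shearFst N from rfl, dft₂_shearFst, Equiv.apply_symm_apply,
        sub_sq_comm]
      exact hnorm _ _)
    (htrans 3 (fun z => z.1) fun z =>
      (dft₂_translate f (1, 0) z).trans (by simp))
    (htrans 4 (fun z => z.2) fun z =>
      (dft₂_translate f (0, 1) z).trans (by simp))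
  simp only [sum_norm_dft₂_sq] at hmain
  nlinarith

end SpectralGap

section Expanders

theorem sum_sq_sum_generators_le {N : ℕ} [NeZero N] (f : ZMod N × ZMod N → ℝ)
    (hf : ∑ x, f x = 0) :
    ∑ x, (∑ s, f (affineGenerators N s x)) ^ 2 ≤ 5 ^ 2 * (1199 / 1200) * ∑ x, f x ^ 2 := by
  have hgap := sum_sq_le_sum_sub_sq f hf
  have hperm : ∀ s, ∑ x, f (affineGenerators N s x) ^ 2 = ∑ x, f x ^ 2 := fun s =>
    Equiv.sum_comp (affineGenerators N s) fun x => f x ^ 2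
  have hpt : ∀ x, (∑ s, f (affineGenerators N s x)) ^ 2 ≤
      5 * ∑ s, f (affineGenerators N s x) ^ 2 - ∑ s, (f (affineGenerators N s x) - f x) ^ 2 := by
    intro x
    simp only [Fin.sum_univ_five]
    rw [show f (affineGenerators N 0 x) = f x from rfl]
    generalize f (affineGenerators N 1 x) = a
    generalize f (affineGenerators N 2 x) = b
    generalize f (affineGenerators N 3 x) = c
    generalize f (affineGenerators N 4 x) = d
    nlinarith [sq_nonneg (a - b), sq_nonneg (a - c), sq_nonneg (a - d), sq_nonneg (b - c),
      sq_nonneg (b - d), sq_nonneg (c - d)]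
  have hsum := Finset.sum_le_sum fun x (_ : x ∈ Finset.univ) => hpt x
  rw [Finset.sum_sub_distrib, ← Finset.mul_sum, Finset.sum_comm, Finset.sum_comm (s := Finset.univ)
    (f := fun x s => (f (affineGenerators N s x) - f x) ^ 2)] at hsum
  simp only [hperm, Finset.sum_const, Finset.card_univ, Fintype.card_fin, nsmul_eq_mul] at hsum
  push_cast at hsum
  linarith

theorem exists_perms_sum_sq_le (N : ℕ) [NeZero N] (t : ℕ) :
    ∃ π : Fin (5 ^ t) → Equiv.Perm (ZMod N × ZMod N),
      ∀ f : ZMod N × ZMod N → ℝ, ∑ x, f x = 0 →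
      ∑ x, (∑ w, f (π w x)) ^ 2 ≤ ((5 ^ t : ℕ) : ℝ) ^ 2 * (1199 / 1200) ^ t * ∑ x, f x ^ 2 := by
  induction t with
  | zero => exact ⟨fun _ => 1, fun f _ => by simp⟩
  | succ t ih =>
    obtain ⟨π, hπ⟩ := ih
    let e : Fin (5 ^ t) × Fin 5 ≃ Fin (5 ^ (t + 1)) := finProdFinEquiv
    refine ⟨fun i => π (e.symm i).1 * affineGenerators N (e.symm i).2, fun f hf => ?_⟩
    have hsum : ∀ x, ∑ i, f ((π (e.symm i).1 * affineGenerators N (e.symm i).2) x) =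
        ∑ s, ∑ w, f (π w (affineGenerators N s x)) := by
      intro x
      rw [← Equiv.sum_comp e, Fintype.sum_prod_type_right]
      simp
    simp only [hsum]
    have hmean : ∑ x, ∑ w, f (π w x) = 0 := by
      rw [Finset.sum_comm]
      simp only [Equiv.sum_comp, hf, Finset.sum_const_zero]
    have h1 := sum_sq_sum_generators_le (fun x => ∑ w, f (π w x)) hmean
    have h2 := hπ f hf
    push_cast at h2 ⊢
    calc _ ≤ _ := h1
      _ ≤ 5 ^ 2 * (1199 / 1200) * ((5 ^ t) ^ 2 * (1199 / 1200) ^ t * ∑ x, f x ^ 2) := by gcongr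
      _ = _ := by ring

theorem sum_sq_sum_inv_le {V ι : Type*} [Fintype V] [Fintype ι] {K : ℝ} (π : ι → Equiv.Perm V)
    (h : ∀ f : V → ℝ, ∑ x, f x = 0 → ∑ x, (∑ i, f (π i x)) ^ 2 ≤ K * ∑ x, f x ^ 2)
    (f : V → ℝ) (hf : ∑ x, f x = 0) :
    ∑ x, (∑ i, f ((π i)⁻¹ x)) ^ 2 ≤ K * ∑ x, f x ^ 2 := by
  set g : V → ℝ := fun x => ∑ i, f ((π i)⁻¹ x) with hg
  have hmean : ∑ x, g x = 0 := by
    rw [hg, Finset.sum_comm]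
    simp only [Equiv.sum_comp, hf, Finset.sum_const_zero]
  have hadj : ∑ x, g x ^ 2 = ∑ x, (∑ i, g (π i x)) * f x := by
    have : ∀ x, g x ^ 2 = ∑ i, g x * f ((π i)⁻¹ x) := fun x => by
      rw [sq, ← Finset.mul_sum]
    simp only [this, Finset.sum_mul]
    rw [Finset.sum_comm, Finset.sum_comm (s := Finset.univ) (t := (Finset.univ : Finset ι))]
    refine Finset.sum_congr rfl fun i _ => ?_
    rw [← Equiv.sum_comp (π i)]
    simp
  have hcs : (∑ x, g x ^ 2) ^ 2 ≤ (K * ∑ x, g x ^ 2) * ∑ x, f x ^ 2 := by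
    conv_lhs => rw [hadj]
    exact (Finset.sum_mul_sq_le_sq_mul_sq _ _ _).trans
      (mul_le_mul_of_nonneg_right (h g hmean) (Finset.sum_nonneg fun _ _ => sq_nonneg _))
  rcases (Finset.sum_nonneg fun x (_ : x ∈ Finset.univ) => sq_nonneg (g x)).eq_or_lt with h0 | h0
  · change ∑ x, g x ^ 2 ≤ _
    rw [← h0]
    by_contra! hneg
    have hf0 : 0 ≤ ∑ x, f x ^ 2 := Finset.sum_nonneg fun _ _ => sq_nonneg _
    have hh := h f hf
    linarith [Finset.sum_nonneg fun x (_ : x ∈ Finset.univ) => sq_nonneg (∑ i, f (π i x))]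
  · refine le_of_mul_le_mul_right ?_ h0
    change (∑ x, g x ^ 2) * _ ≤ _
    nlinarith

/-- A family of permutations together with their inverses. -/
def withInverses {V ι : Type*} (π : ι → Equiv.Perm V) : ι ⊕ ι → Equiv.Perm V :=
  Sum.elim π fun i => (π i)⁻¹

theorem sum_sq_sum_withInverses_le {V ι : Type*} [Fintype V] [Fintype ι] {K : ℝ}
    (π : ι → Equiv.Perm V)
    (h : ∀ f : V → ℝ, ∑ x, f x = 0 → ∑ x, (∑ i, f (π i x)) ^ 2 ≤ K * ∑ x, f x ^ 2)
    (f : V → ℝ) (hf : ∑ x, f x = 0) :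
    ∑ x, (∑ i, f (withInverses π i x)) ^ 2 ≤ 4 * K * ∑ x, f x ^ 2 := by
  have h1 := h f hf
  have h2 := sum_sq_sum_inv_le π h f hf
  have h3 : ∀ x, (∑ i, f (withInverses π i x)) ^ 2 ≤
      2 * (∑ i, f (π i x)) ^ 2 + 2 * (∑ i, f ((π i)⁻¹ x)) ^ 2 := fun x => by
    rw [Fintype.sum_sum_type]
    simp only [withInverses, Sum.elim_inl, Sum.elim_inr]
    nlinarith [sq_nonneg (∑ i, f (π i x) - ∑ i, f ((π i)⁻¹ x))]
  have h4 := Finset.sum_le_sum fun x (_ : x ∈ Finset.univ) => h3 x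
  rw [Finset.sum_add_distrib, ← Finset.mul_sum, ← Finset.mul_sum] at h4
  linarith

end Expanders

section Heisenberg

/-- The standard symplectic form on the plane. -/
def sympl {F : Type*} [Ring F] (p b : F × F) : F := p.1 * b.2 - p.2 * b.1

variable {F : Type*} [Field F] [Fintype F]

theorem sum_sympl (h : F → ℝ) (y : F) {u : F × F} (hu : u ≠ 0) :
    ∑ p, h (y + sympl p u) = Fintype.card F * ∑ z, h z := by
  classical
  have hbij : ∀ c d : F, c ≠ 0 → ∑ s, h (d + s * c) = ∑ z, h z := fun c d hc =>
    Equiv.sum_comp ((Equiv.mulRight₀ c hc).trans (Equiv.addLeft d)) h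
  by_cases h2 : u.2 = 0
  · have h1 : -u.1 ≠ 0 := fun h1 => hu (Prod.ext (neg_eq_zero.1 h1) h2)
    rw [Fintype.sum_prod_type]
    have : ∀ a b : F, y + sympl (a, b) u = y + b * -u.1 := fun a b => by
      simp only [sympl, h2]
      ring
    simp only [this, hbij _ _ h1, Finset.sum_const, Finset.card_univ, nsmul_eq_mul]
  · rw [Fintype.sum_prod_type_right]
    have : ∀ a b : F, y + sympl (a, b) u = (y - b * u.1) + a * u.2 := fun a b => by
      simp only [sympl]
      ring
    simp only [this, hbij _ _ h2, Finset.sum_const, Finset.card_univ, nsmul_eq_mul]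

/-- The operator summing `g` over the points `(b, y)` with `sympl p b + x - y = t`. -/
noncomputable def heisOp (t : F) (g : (F × F) × F → ℝ) (a : (F × F) × F) : ℝ :=
  ∑ b, g (b, a.2 + sympl a.1 b - t)

theorem sum_heisOp (t : F) (g : (F × F) × F → ℝ) :
    ∑ a, heisOp t g a = (Fintype.card F : ℝ) ^ 2 * ∑ a, g a := by
  simp only [heisOp]
  rw [Fintype.sum_prod_type]
  have : ∀ p b : F × F, ∑ x, g (b, x + sympl p b - t) = ∑ y, g (b, y) := fun p b => by
    rw [← Equiv.sum_comp (Equiv.addRight (sympl p b - t)) fun y => g (b, y)]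
    simp [add_sub_assoc]
  have h2 : ∀ p : F × F, ∑ x, ∑ b, g (b, x + sympl p b - t) = ∑ a, g a := fun p => by
    rw [Finset.sum_comm]
    simp only [this]
    exact (Fintype.sum_prod_type _).symm
  simp only [h2, Finset.sum_const, Finset.card_univ, nsmul_eq_mul, Fintype.card_prod]
  push_cast
  ring

theorem sum_heisOp_sq_le (t : F) (g : (F × F) × F → ℝ) :
    ∑ a, heisOp t g a ^ 2 ≤
      (Fintype.card F : ℝ) ^ 2 * ∑ a, g a ^ 2 + Fintype.card F * (∑ a, g a) ^ 2 := by
  classical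
  set q : ℝ := (Fintype.card F : ℝ) with hq
  set G : F × F → ℝ := fun b => ∑ y, g (b, y) with hG
  have hpair : ∀ b b' : F × F,
      ∑ p : F × F, ∑ x, g (b, x + sympl p b - t) * g (b', x + sympl p b' - t) =
        q * (G b * G b') + if b = b' then q ^ 2 * ∑ y, g (b, y) ^ 2 - q * G b ^ 2 else 0 := by
    intro b b'
    have hsub : ∀ p : F × F, ∑ x, g (b, x + sympl p b - t) * g (b', x + sympl p b' - t) =
        ∑ y, g (b, y) * g (b', y + sympl p (b' - b)) := fun p => by
      rw [← Equiv.sum_comp (Equiv.addRight (sympl p b - t))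
        fun y => g (b, y) * g (b', y + sympl p (b' - b))]
      refine Finset.sum_congr rfl fun x _ => ?_
      simp only [Equiv.coe_addRight, sympl, Prod.fst_sub, Prod.snd_sub]
      congr 3 <;> ring
    simp only [hsub]
    split_ifs with hb
    · subst hb
      simp only [sub_self, sympl, Prod.fst_zero, Prod.snd_zero, mul_zero, add_zero,
        Finset.sum_const, Finset.card_univ, nsmul_eq_mul, Fintype.card_prod, ← sq]
      push_cast
      ring
    · rw [Finset.sum_comm]
      simp only [← Finset.mul_sum]
      simp only [sum_sympl (fun z => g (b', z)) _ (sub_ne_zero.2 (Ne.symm hb)), ← Finset.sum_mul]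
      rw [add_zero]
      ring
  have hexp : ∑ a, heisOp t g a ^ 2 = ∑ b : F × F, ∑ b' : F × F,
      ∑ p : F × F, ∑ x, g (b, x + sympl p b - t) * g (b', x + sympl p b' - t) := by
    simp only [heisOp, sq, Finset.sum_mul_sum]
    rw [Finset.sum_comm]
    refine Finset.sum_congr rfl fun b _ => ?_
    rw [Finset.sum_comm]
    refine Finset.sum_congr rfl fun b' _ => ?_
    rw [Fintype.sum_prod_type]
  have hsumG : ∑ a, g a = ∑ b, G b := Fintype.sum_prod_type _
  have hsumg : ∑ a, g a ^ 2 = ∑ b, ∑ y, g (b, y) ^ 2 := Fintype.sum_prod_type _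
  rw [hexp]
  simp only [hpair, Finset.sum_add_distrib, Finset.sum_ite_eq, Finset.mem_univ, if_true,
    ← Finset.mul_sum, Finset.sum_sub_distrib, ← Finset.sum_mul]
  rw [hsumG, hsumg]
  have : 0 ≤ q * ∑ b, G b ^ 2 := by positivity
  nlinarith

theorem sum_heisOp_sub_sq_le (t : F) (g : (F × F) × F → ℝ) :
    ∑ a, (heisOp t g a - (∑ b, g b) / Fintype.card F) ^ 2 ≤
      (Fintype.card F : ℝ) ^ 2 * ∑ a, g a ^ 2 := by
  have hq : (Fintype.card F : ℝ) ≠ 0 := by exact_mod_cast Fintype.card_ne_zero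
  have h1 := sum_heisOp_sq_le t g
  have h2 := sum_heisOp t g
  set q : ℝ := (Fintype.card F : ℝ) with hqdef
  set S : ℝ := ∑ b, g b
  have h3 : ∑ a, (heisOp t g a - S / q) ^ 2 =
      ∑ a, heisOp t g a ^ 2 - 2 * (S / q) * ∑ a, heisOp t g a + q ^ 3 * (S / q) ^ 2 := by
    have : ∀ a, (heisOp t g a - S / q) ^ 2 =
        heisOp t g a ^ 2 - 2 * (S / q) * heisOp t g a + (S / q) ^ 2 := fun a => by ring
    simp only [this, Finset.sum_add_distrib, Finset.sum_sub_distrib, ← Finset.mul_sum,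
      Finset.sum_const, Finset.card_univ, nsmul_eq_mul, Fintype.card_prod]
    push_cast
    ring
  rw [h3, h2]
  have h4 : -(2 * (S / q) * (q ^ 2 * S)) + q ^ 3 * (S / q) ^ 2 = -(q * S ^ 2) := by
    field_simp
    ring
  linarith

/-- The graph on `V × F³` in which `(v, a)` is joined to `(σ i v, b)` whenever the twisted
difference of `a` and `b` equals the label `φ i`. -/
def labelledGraph {V ι : Type*} (φ : ι → F) (σ : ι → Equiv.Perm V) (inv : ι → ι)
    (hφ0 : ∀ i, φ i ≠ 0) (hφ : ∀ i, φ (inv i) = -φ i) (hσ : ∀ i, σ (inv i) = (σ i)⁻¹) :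
    SimpleGraph (V × ((F × F) × F)) where
  Adj x y := ∃ i, sympl x.2.1 y.2.1 + x.2.2 - y.2.2 = φ i ∧ y.1 = σ i x.1
  symm := ⟨by
    rintro x y ⟨i, h1, h2⟩
    refine ⟨inv i, ?_, ?_⟩
    · rw [hφ, ← h1]
      simp only [sympl]
      ring
    · rw [hσ, h2]
      simp⟩
  loopless := ⟨by
    rintro x ⟨i, h, -⟩
    refine hφ0 i ?_
    rw [← h]
    simp only [sympl]
    ring⟩

theorem adjOp_labelledGraph
    {V ι : Type*} [Fintype V] [Fintype ι] {φ : ι → F} {σ : ι → Equiv.Perm V} {inv : ι → ι}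
    (hφ0 : ∀ i, φ i ≠ 0) (hφ : ∀ i, φ (inv i) = -φ i) (hσ : ∀ i, σ (inv i) = (σ i)⁻¹)
    (hinj : Function.Injective φ) (f : V × ((F × F) × F) → ℝ) (v : V)
    (a : (F × F) × F) :
    adjOp (labelledGraph φ σ inv hφ0 hφ hσ) f (v, a) =
      ∑ i, heisOp (φ i) (fun b => f (σ i v, b)) a := by
  classical
  have h1 : ∀ y : V × ((F × F) × F),
      (if (labelledGraph φ σ inv hφ0 hφ hσ).Adj (v, a) y then f y else 0) =
        ∑ i, if sympl a.1 y.2.1 + a.2 - y.2.2 = φ i ∧ y.1 = σ i v then f y else 0 := by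
    intro y
    by_cases h : (labelledGraph φ σ inv hφ0 hφ hσ).Adj (v, a) y
    · rw [if_pos h]
      obtain ⟨i, hi⟩ := h
      rw [Finset.sum_eq_single i, if_pos hi]
      · intro j _ hj
        rw [if_neg]
        rintro ⟨hj', -⟩
        exact hj (hinj (hj'.symm.trans hi.1))
      · simp
    · rw [if_neg h, Finset.sum_eq_zero]
      intro i _
      rw [if_neg]
      exact fun hi => h ⟨i, hi⟩
  have h2 : adjOp (labelledGraph φ σ inv hφ0 hφ hσ) f (v, a) = ∑ y : V × ((F × F) × F),
      if (labelledGraph φ σ inv hφ0 hφ hσ).Adj (v, a) y then f y else 0 := by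
    simp only [adjOp]
  rw [h2]
  simp only [h1]
  rw [Finset.sum_comm]
  refine Finset.sum_congr rfl fun i _ => ?_
  rw [Fintype.sum_prod_type, Finset.sum_eq_single (σ i v), heisOp, Fintype.sum_prod_type]
  · refine Finset.sum_congr rfl fun b _ => ?_
    rw [Finset.sum_eq_single (a.2 + sympl a.1 b - φ i), if_pos]
    · exact ⟨by ring, rfl⟩
    · intro y _ hy
      rw [if_neg]
      rintro ⟨h, -⟩
      refine hy ?_
      rw [← h]
      ring
    · simp
  · intro u _ hu
    simp [hu]
  · simp

theorem adjOp_labelledGraph_one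
    {V ι : Type*} [Fintype V] [Fintype ι] {φ : ι → F} {σ : ι → Equiv.Perm V} {inv : ι → ι}
    (hφ0 : ∀ i, φ i ≠ 0) (hφ : ∀ i, φ (inv i) = -φ i) (hσ : ∀ i, σ (inv i) = (σ i)⁻¹)
    (hinj : Function.Injective φ) (x : V × ((F × F) × F)) :
    adjOp (labelledGraph φ σ inv hφ0 hφ hσ) (fun _ => 1) x =
      Fintype.card ι * (Fintype.card F : ℝ) ^ 2 := by
  obtain ⟨v, a⟩ := x
  rw [adjOp_labelledGraph hφ0 hφ hσ hinj]
  simp [heisOp, sq]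

theorem sum_sq_adjOp_labelledGraph_le
    {V ι : Type*} [Fintype V] [Fintype ι] {φ : ι → F} {σ : ι → Equiv.Perm V} {inv : ι → ι}
    (hφ0 : ∀ i, φ i ≠ 0) (hφ : ∀ i, φ (inv i) = -φ i) (hσ : ∀ i, σ (inv i) = (σ i)⁻¹)
    (hinj : Function.Injective φ) {K : ℝ}
    (hK : ∀ f : V → ℝ, ∑ v, f v = 0 → ∑ v, (∑ i, f (σ i v)) ^ 2 ≤ K * ∑ v, f v ^ 2)
    (hK0 : 0 ≤ K) (f : V × ((F × F) × F) → ℝ) (hf : ∑ x, f x = 0) :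
    ∑ x, adjOp (labelledGraph φ σ inv hφ0 hφ hσ) f x ^ 2 ≤
      2 * ((Fintype.card F : ℝ) ^ 4 * K + (Fintype.card ι * (Fintype.card F : ℝ)) ^ 2) *
        ∑ x, f x ^ 2 := by
  have hq : (Fintype.card F : ℝ) ≠ 0 := by exact_mod_cast Fintype.card_ne_zero
  set q : ℝ := (Fintype.card F : ℝ) with hqdef
  set m : ℝ := (Fintype.card ι : ℝ) with hm
  set g : V → ℝ := fun v => ∑ b, f (v, b) with hg
  have hg0 : ∑ v, g v = 0 := by rw [← hf, Fintype.sum_prod_type]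
  have hgf : ∑ v, g v ^ 2 ≤ q ^ 3 * ∑ x, f x ^ 2 := by
    rw [Fintype.sum_prod_type, Finset.mul_sum]
    refine Finset.sum_le_sum fun v _ => ?_
    have := sq_sum_le_card_mul_sum_sq (s := Finset.univ) (f := fun b => f (v, b))
    simp only [Finset.card_univ, Fintype.card_prod] at this
    push_cast at this
    calc _ ≤ _ := this
      _ = _ := by ring
  set R : ι → V × ((F × F) × F) → ℝ :=
    fun i x => heisOp (φ i) (fun b => f (σ i x.1, b)) x.2 - g (σ i x.1) / q with hR
  have hRi : ∀ i, ∑ x, R i x ^ 2 ≤ q ^ 2 * ∑ x, f x ^ 2 := by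
    intro i
    rw [Fintype.sum_prod_type, Fintype.sum_prod_type, Finset.mul_sum,
      ← Equiv.sum_comp (σ i) fun v => q ^ 2 * ∑ y, f (v, y) ^ 2]
    exact Finset.sum_le_sum fun v _ => sum_heisOp_sub_sq_le (φ i) fun b => f (σ i v, b)
  have hRsum : ∑ x, (∑ i, R i x) ^ 2 ≤ (m * q) ^ 2 * ∑ x, f x ^ 2 := by
    calc ∑ x, (∑ i, R i x) ^ 2 ≤ ∑ x, m * ∑ i, R i x ^ 2 := by
          refine Finset.sum_le_sum fun x _ => ?_
          exact sq_sum_le_card_mul_sum_sq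
      _ = m * ∑ i, ∑ x, R i x ^ 2 := by rw [← Finset.mul_sum, Finset.sum_comm]
      _ ≤ m * ∑ _i : ι, q ^ 2 * ∑ x, f x ^ 2 := by
          gcongr with i
          exact hRi i
      _ = _ := by
          rw [Finset.sum_const, Finset.card_univ, nsmul_eq_mul]
          ring
  have hmain : ∑ x : V × ((F × F) × F), (∑ i, g (σ i x.1) / q) ^ 2 ≤
      q ^ 4 * K * ∑ x, f x ^ 2 := by
    have h1 : ∑ x : V × ((F × F) × F), (∑ i, g (σ i x.1) / q) ^ 2 =
        q * ∑ v, (∑ i, g (σ i v)) ^ 2 := by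
      rw [Fintype.sum_prod_type]
      simp only [← Finset.sum_div, div_pow, Finset.sum_const, Finset.card_univ,
        Fintype.card_prod, nsmul_eq_mul, ← Finset.mul_sum]
      push_cast
      rw [← hqdef]
      field_simp
    rw [h1]
    have hq0 : 0 ≤ q := Nat.cast_nonneg _
    calc q * ∑ v, (∑ i, g (σ i v)) ^ 2 ≤ q * (K * (q ^ 3 * ∑ x, f x ^ 2)) := by
          gcongr
          exact (hK g hg0).trans (mul_le_mul_of_nonneg_left hgf hK0)
      _ = _ := by ring
  have hpt : ∀ x, adjOp (labelledGraph φ σ inv hφ0 hφ hσ) f x ^ 2 ≤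
      2 * (∑ i, g (σ i x.1) / q) ^ 2 + 2 * (∑ i, R i x) ^ 2 := by
    rintro ⟨v, a⟩
    have : adjOp (labelledGraph φ σ inv hφ0 hφ hσ) f (v, a) =
        ∑ i, g (σ i v) / q + ∑ i, R i (v, a) := by
      rw [adjOp_labelledGraph hφ0 hφ hσ hinj, ← Finset.sum_add_distrib]
      simp [hR]
    rw [this]
    nlinarith [sq_nonneg (∑ i, g (σ i v) / q - ∑ i, R i (v, a))]
  have h4 := Finset.sum_le_sum fun x (_ : x ∈ Finset.univ) => hpt x
  rw [Finset.sum_add_distrib, ← Finset.mul_sum, ← Finset.mul_sum] at h4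
  linarith

end Heisenberg

section InducedTypes

/-- The induced subgraphs of `G` are classified up to isomorphism by at most `M` types. -/
def TypeBound {V : Type} (G : SimpleGraph V) (M : ℕ) : Prop :=
  ∃ (T : Type) (_ : Fintype T) (τ : Set V → T), Fintype.card T ≤ M ∧
    ∀ S S' : Set V, τ S = τ S' → Nonempty (G.induce S ≃g G.induce S')

theorem TypeBound.card_le {V : Type} {G : SimpleGraph V} {M : ℕ} (h : TypeBound G M) {N : ℕ}
    (f : Fin N → Set V)
    (hf : ∀ i j : Fin N, i ≠ j → IsEmpty (G.induce (f i) ≃g G.induce (f j))) : N ≤ M := by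
  obtain ⟨T, _, τ, hcard, hτ⟩ := h
  have hinj : Function.Injective fun i => τ (f i) := by
    intro i j hij
    by_contra hne
    exact (not_nonempty_iff.2 (hf i j hne)) (hτ _ _ hij)
  simpa using (Fintype.card_le_of_injective _ hinj).trans hcard

/-- An equivalence of vertex types preserving adjacency on subsets that it matches restricts to
an isomorphism of induced subgraphs. -/
def inducedIso {V W : Type} {G : SimpleGraph V} {H : SimpleGraph W} {S : Set V} {S' : Set W}
    (e : V ≃ W) (hS : ∀ x, x ∈ S ↔ e x ∈ S')
    (hadj : ∀ x ∈ S, ∀ y ∈ S, H.Adj (e x) (e y) ↔ G.Adj x y) : G.induce S ≃g H.induce S' where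
  toEquiv := e.subtypeEquiv hS
  map_rel_iff' := by
    rintro ⟨x, hx⟩ ⟨y, hy⟩
    exact hadj x hx y hy

theorem TypeBound.comap {V W : Type} {G : SimpleGraph V} {M : ℕ} (h : TypeBound G M)
    (e : W ≃ V) : TypeBound (G.comap e) M := by
  obtain ⟨T, _, τ, hcard, hτ⟩ := h
  refine ⟨T, inferInstance, fun S => τ (e '' S), hcard, fun S S' hSS => ?_⟩
  obtain ⟨φ⟩ := hτ _ _ hSS
  have key : ∀ S : Set W, Nonempty ((G.comap e).induce S ≃g G.induce (e '' S)) := fun S =>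
    ⟨inducedIso e (fun x => by simp) fun x _ y _ => Iff.rfl⟩
  obtain ⟨a⟩ := key S
  obtain ⟨b⟩ := key S'
  exact ⟨(a.trans φ).trans b.symm⟩

theorem typeBound_two_pow {V : Type} [Fintype V] (G : SimpleGraph V) :
    TypeBound G (2 ^ Fintype.card V) := by
  classical
  refine ⟨Set V, inferInstance, id, by simp, fun S S' h => ?_⟩
  obtain rfl : S = S' := h
  exact ⟨SimpleGraph.Iso.refl⟩

theorem TypeBound.sum {V W : Type} {G : SimpleGraph V} {H : SimpleGraph W} {M M' : ℕ}
    (hG : TypeBound G M) (hH : TypeBound H M') : TypeBound (G ⊕g H) (M * M') := by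
  obtain ⟨T, _, τ, hcard, hτ⟩ := hG
  obtain ⟨T', _, τ', hcard', hτ'⟩ := hH
  refine ⟨T × T', inferInstance, fun S => (τ (Sum.inl ⁻¹' S), τ' (Sum.inr ⁻¹' S)), ?_, ?_⟩
  · rw [Fintype.card_prod]
    exact Nat.mul_le_mul hcard hcard'
  · intro S S' h
    obtain ⟨h1, h2⟩ := Prod.mk.inj h
    obtain ⟨a⟩ := hτ _ _ h1
    obtain ⟨b⟩ := hτ' _ _ h2
    refine ⟨⟨⟨fun
      | ⟨.inl v, h⟩ => ⟨.inl (a ⟨v, h⟩).1, (a ⟨v, h⟩).2⟩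
      | ⟨.inr w, h⟩ => ⟨.inr (b ⟨w, h⟩).1, (b ⟨w, h⟩).2⟩, fun
      | ⟨.inl v, h⟩ => ⟨.inl (a.symm ⟨v, h⟩).1, (a.symm ⟨v, h⟩).2⟩
      | ⟨.inr w, h⟩ => ⟨.inr (b.symm ⟨w, h⟩).1, (b.symm ⟨w, h⟩).2⟩, ?_, ?_⟩, ?_⟩⟩
    · rintro ⟨v | w, h⟩
      · exact Subtype.ext (congrArg (Sum.inl ∘ Subtype.val) (a.symm_apply_apply ⟨v, h⟩))
      · exact Subtype.ext (congrArg (Sum.inr ∘ Subtype.val) (b.symm_apply_apply ⟨w, h⟩))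
    · rintro ⟨v | w, h⟩
      · exact Subtype.ext (congrArg (Sum.inl ∘ Subtype.val) (a.apply_symm_apply ⟨v, h⟩))
      · exact Subtype.ext (congrArg (Sum.inr ∘ Subtype.val) (b.apply_symm_apply ⟨w, h⟩))
    · rintro ⟨v | w, h⟩ ⟨v' | w', h'⟩
      · exact a.map_rel_iff' (a := ⟨v, h⟩) (b := ⟨v', h'⟩)
      · simp
      · simp
      · exact b.map_rel_iff' (a := ⟨w, h⟩) (b := ⟨w', h'⟩)

/-- The lexicographic product: every vertex of `G` is replaced by a copy of `H`. -/
def lexProduct {V W : Type} (G : SimpleGraph V) (H : SimpleGraph W) : SimpleGraph (V × W) where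
  Adj x y := G.Adj x.1 y.1 ∨ (x.1 = y.1 ∧ H.Adj x.2 y.2)
  symm := ⟨by
    rintro x y (h | ⟨h, h'⟩)
    · exact Or.inl h.symm
    · exact Or.inr ⟨h.symm, h'.symm⟩⟩
  loopless := ⟨by
    rintro x (h | ⟨-, h⟩)
    · exact G.loopless.irrefl _ h
    · exact H.loopless.irrefl _ h⟩

theorem TypeBound.lexProduct {V W : Type} [Fintype V] {G : SimpleGraph V} {H : SimpleGraph W}
    {M : ℕ} (hH : TypeBound H M) : TypeBound (lexProduct G H) (M ^ Fintype.card V) := by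
  classical
  obtain ⟨T, _, τ, hcard, hτ⟩ := hH
  refine ⟨V → T, inferInstance, fun S v => τ {w | (v, w) ∈ S}, ?_, ?_⟩
  · rw [Fintype.card_fun]
    exact Nat.pow_le_pow_left hcard _
  · intro S S' h
    have a := fun v => (hτ _ _ (congrFun h v)).some
    refine ⟨⟨⟨
      fun x => ⟨(x.1.1, (a x.1.1 ⟨x.1.2, x.2⟩).1), (a x.1.1 ⟨x.1.2, x.2⟩).2⟩,
      fun x => ⟨(x.1.1, ((a x.1.1).symm ⟨x.1.2, x.2⟩).1), ((a x.1.1).symm ⟨x.1.2, x.2⟩).2⟩,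
      ?_, ?_⟩, ?_⟩⟩
    · rintro ⟨⟨v, w⟩, hx⟩
      exact Subtype.ext (Prod.ext rfl (congrArg Subtype.val ((a v).symm_apply_apply ⟨w, hx⟩)))
    · rintro ⟨⟨v, w⟩, hx⟩
      exact Subtype.ext (Prod.ext rfl (congrArg Subtype.val ((a v).apply_symm_apply ⟨w, hx⟩)))
    · rintro ⟨⟨v, w⟩, hx⟩ ⟨⟨v', w'⟩, hx'⟩
      by_cases hv : v = v'
      · subst hv
        have := (a v).map_rel_iff' (a := ⟨w, hx⟩) (b := ⟨w', hx'⟩)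
        simpa [_root_.lexProduct] using this
      · simp [_root_.lexProduct, hv]

theorem typeBound_lexProduct_bot {W : Type} [Fintype W] (l : ℕ) (H : SimpleGraph W) :
    TypeBound (lexProduct (⊥ : SimpleGraph (Fin l)) H) ((l + 1) ^ 2 ^ Fintype.card W) := by
  classical
  refine ⟨Set W → Fin (l + 1), inferInstance, fun S A =>
    ⟨Fintype.card {i : Fin l // {w | (i, w) ∈ S} = A}, ?_⟩, ?_, ?_⟩
  · rw [Nat.lt_succ_iff]
    simpa using Fintype.card_subtype_le fun i : Fin l => {w | (i, w) ∈ S} = A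
  · simp
  · intro S S' h
    have hcard : ∀ A, Nonempty ({i : Fin l // {w | (i, w) ∈ S} = A} ≃
        {i : Fin l // {w | (i, w) ∈ S'} = A}) := fun A => by
      rw [← Fintype.card_eq]
      exact congrArg Fin.val (congrFun h A)
    let e : Fin l ≃ Fin l := ((Equiv.sigmaFiberEquiv fun i => {w | (i, w) ∈ S}).symm.trans
      (Equiv.sigmaCongrRight fun A => (hcard A).some)).trans
      (Equiv.sigmaFiberEquiv fun i => {w | (i, w) ∈ S'})
    have he : ∀ i, {w | (e i, w) ∈ S'} = {w | (i, w) ∈ S} := fun i =>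
      ((hcard _).some ⟨i, rfl⟩).2
    refine ⟨inducedIso (e.prodCongr (Equiv.refl W)) (fun x => ?_) fun x _ y _ => ?_⟩
    · exact (Set.ext_iff.1 (he x.1) x.2).symm
    · simp [_root_.lexProduct]

end InducedTypes

section Products

theorem adjOp_lexProduct {V W : Type} [Fintype V] [Fintype W] (G : SimpleGraph V)
    (H : SimpleGraph W) (f : V × W → ℝ) (v : V) (w : W) :
    adjOp (lexProduct G H) f (v, w) =
      adjOp G (fun u => ∑ x, f (u, x)) v + adjOp H (fun x => f (v, x)) w := by
  classical
  have hpt : ∀ u x, (if (lexProduct G H).Adj (v, w) (u, x) then f (u, x) else 0) =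
      (if G.Adj v u then f (u, x) else 0) +
        if v = u then (if H.Adj w x then f (u, x) else 0) else 0 := by
    intro u x
    by_cases hu : v = u
    · subst hu
      simp [lexProduct]
    · simp [lexProduct, hu]
  calc adjOp (lexProduct G H) f (v, w)
      = ∑ y : V × W, if (lexProduct G H).Adj (v, w) y then f y else 0 := by simp only [adjOp]
    _ = ∑ u, ∑ x, (if G.Adj v u then f (u, x) else 0) +
        ∑ u, ∑ x, if v = u then (if H.Adj w x then f (u, x) else 0) else 0 := by
      rw [Fintype.sum_prod_type]
      simp only [hpt, Finset.sum_add_distrib]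
    _ = _ := by
      congr 1
      · simp only [adjOp]
        refine Finset.sum_congr rfl fun u _ => ?_
        split_ifs <;> simp
      · rw [Finset.sum_comm]
        simp only [adjOp, Finset.sum_ite_eq, Finset.mem_univ, if_true]

theorem adjOp_sum_inl {V W : Type} [Fintype V] [Fintype W] (G : SimpleGraph V)
    (H : SimpleGraph W) (f : V ⊕ W → ℝ) (v : V) :
    adjOp (G ⊕g H) f (.inl v) = adjOp G (fun u => f (.inl u)) v := by
  classical
  simp only [adjOp, Fintype.sum_sum_type]
  simp

theorem adjOp_sum_inr {V W : Type} [Fintype V] [Fintype W] (G : SimpleGraph V)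
    (H : SimpleGraph W) (f : V ⊕ W → ℝ) (w : W) :
    adjOp (G ⊕g H) f (.inr w) = adjOp H (fun u => f (.inr u)) w := by
  classical
  simp only [adjOp, Fintype.sum_sum_type]
  simp

theorem adjOp_comap {V W : Type} [Fintype V] [Fintype W] (G : SimpleGraph V) (e : W ≃ V)
    (f : W → ℝ) (w : W) : adjOp (G.comap e) f w = adjOp G (fun v => f (e.symm v)) (e w) := by
  classical
  simp only [adjOp]
  rw [← Equiv.sum_comp e]
  simp

theorem SpectralBound.comap {V W : Type} [Fintype V] [Fintype W] {G : SimpleGraph V} {lam : ℝ}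
    (h : SpectralBound G lam) (e : W ≃ V) : SpectralBound (G.comap e) lam := by
  intro f hf
  have := h (fun v => f (e.symm v)) (by rwa [Equiv.sum_comp e.symm f])
  rw [Equiv.sum_comp e.symm fun w => f w ^ 2, ← Equiv.sum_comp e] at this
  simpa only [adjOp_comap] using this

theorem sum_sq_adjOp_le {V : Type*} [Fintype V] (G : SimpleGraph V) {r : ℝ}
    (hr : ∀ v, adjOp G (fun _ => 1) v = r) (f : V → ℝ) :
    ∑ v, adjOp G f v ^ 2 ≤ r ^ 2 * ∑ v, f v ^ 2 := by
  classical
  have hpt : ∀ v, adjOp G f v ^ 2 ≤ r * adjOp G (fun u => f u ^ 2) v := by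
    intro v
    rw [← hr v]
    simp only [adjOp]
    rw [← Finset.sum_filter, ← Finset.sum_filter, ← Finset.sum_filter]
    simpa using sq_sum_le_card_mul_sum_sq (s := {u | G.Adj v u}) (f := f)
  have hsymm := adjOp_symm G (fun u => f u ^ 2) fun _ => 1
  simp only [mul_one, hr, ← Finset.sum_mul] at hsymm
  calc ∑ v, adjOp G f v ^ 2 ≤ ∑ v, r * adjOp G (fun u => f u ^ 2) v :=
        Finset.sum_le_sum fun v _ => hpt v
    _ = r ^ 2 * ∑ v, f v ^ 2 := by
        rw [← Finset.mul_sum, hsymm]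
        ring

theorem SpectralBound.lexProduct {V W : Type} [Fintype V] [Fintype W] {G : SimpleGraph V}
    {H : SimpleGraph W} {lam r mu : ℝ} (hG : SpectralBound G lam)
    (hr : ∀ w, adjOp H (fun _ => 1) w = r)
    (hmu : 2 * (Fintype.card W * lam) ^ 2 + 2 * r ^ 2 ≤ mu ^ 2) :
    SpectralBound (lexProduct G H) mu := by
  intro f hf
  set k : ℝ := (Fintype.card W : ℝ) with hk
  set g : V → ℝ := fun v => ∑ w, f (v, w) with hg
  have hg0 : ∑ v, g v = 0 := by rw [← hf, Fintype.sum_prod_type]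
  have hgf : ∑ v, g v ^ 2 ≤ k * ∑ x, f x ^ 2 := by
    rw [Fintype.sum_prod_type, Finset.mul_sum]
    exact Finset.sum_le_sum fun v _ => sq_sum_le_card_mul_sum_sq
  have h1 : ∑ x : V × W, adjOp G g x.1 ^ 2 ≤ (k * lam) ^ 2 * ∑ x, f x ^ 2 := by
    rw [Fintype.sum_prod_type]
    simp only [Finset.sum_const, Finset.card_univ, nsmul_eq_mul, ← Finset.mul_sum]
    have hk0 : 0 ≤ k := Nat.cast_nonneg _
    calc k * ∑ v, adjOp G g v ^ 2 ≤ k * (lam ^ 2 * (k * ∑ x, f x ^ 2)) := by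
          gcongr
          exact (hG g hg0).trans (by gcongr)
      _ = _ := by ring
  have h2 : ∑ x : V × W, adjOp H (fun w => f (x.1, w)) x.2 ^ 2 ≤ r ^ 2 * ∑ x, f x ^ 2 := by
    rw [Fintype.sum_prod_type, Fintype.sum_prod_type, Finset.mul_sum]
    exact Finset.sum_le_sum fun v _ => sum_sq_adjOp_le H hr fun w => f (v, w)
  have hpt : ∀ x : V × W, adjOp (_root_.lexProduct G H) f x ^ 2 ≤
      2 * adjOp G g x.1 ^ 2 + 2 * adjOp H (fun w => f (x.1, w)) x.2 ^ 2 := by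
    rintro ⟨v, w⟩
    rw [adjOp_lexProduct]
    nlinarith [sq_nonneg (adjOp G g v - adjOp H (fun w => f (v, w)) w)]
  have h4 := Finset.sum_le_sum fun x (_ : x ∈ Finset.univ) => hpt x
  rw [Finset.sum_add_distrib, ← Finset.mul_sum, ← Finset.mul_sum] at h4
  have h5 := mul_le_mul_of_nonneg_right hmu
    (Finset.sum_nonneg fun x (_ : x ∈ Finset.univ) => sq_nonneg (f x))
  linarith

/-- A bipartite circulant graph with `r`-element neighbourhoods. -/
def bipartiteCirculant (g r : ℕ) : SimpleGraph (Bool × ZMod g) where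
  Adj x y := x.1 ≠ y.1 ∧ (x.2 + y.2).val < r
  symm := ⟨fun x y h => ⟨h.1.symm, by rw [add_comm]; exact h.2⟩⟩
  loopless := ⟨fun x h => h.1 rfl⟩

theorem adjOp_bipartiteCirculant {g r : ℕ} [NeZero g] (hr : r ≤ g) (x : Bool × ZMod g) :
    adjOp (bipartiteCirculant g r) (fun _ => 1) x = r := by
  classical
  obtain ⟨b, z⟩ := x
  have hcount : ∑ y : ZMod g, (if (z + y).val < r then (1 : ℝ) else 0) = r := by
    refine (Equiv.sum_comp (Equiv.addLeft z)
      fun y : ZMod g => if y.val < r then (1 : ℝ) else 0).trans ?_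
    rw [Finset.sum_boole, Nat.cast_inj, ← Finset.card_map ⟨ZMod.val, ZMod.val_injective g⟩]
    convert Finset.card_range r
    ext m
    simp only [Finset.mem_map, Finset.mem_filter, Finset.mem_univ, true_and,
      Function.Embedding.coeFn_mk, Finset.mem_range]
    constructor
    · rintro ⟨y, hy, rfl⟩
      exact hy
    · intro hm
      exact ⟨m, by rwa [ZMod.val_cast_of_lt (hm.trans_le hr)],
        ZMod.val_cast_of_lt (hm.trans_le hr)⟩
  calc adjOp (bipartiteCirculant g r) (fun _ => 1) (b, z)
      = ∑ y : Bool × ZMod g, if b ≠ y.1 ∧ (z + y.2).val < r then (1 : ℝ) else 0 := by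
        simp only [adjOp]
        exact Finset.sum_congr rfl fun y _ => if_congr Iff.rfl rfl rfl
    _ = r := by
        rw [Fintype.sum_prod_type]
        cases b <;> simpa using hcount

end Products

section Assembly

theorem exists_base_graph {δ : ℝ} (hδ : 0 < δ) : ∃ D : ℕ, 0 < D ∧ ∀ N₀ : ℕ,
    ∃ (V : Type) (_ : Fintype V) (G : SimpleGraph V), N₀ ≤ Fintype.card V ∧ 0 < Fintype.card V ∧
      (∀ v, adjOp G (fun _ => 1) v = D) ∧ SpectralBound G (D * δ) := by
  obtain ⟨t, ht⟩ := exists_pow_lt_of_lt_one (show 0 < δ ^ 2 / 4 by positivity)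
    (show (1199 / 1200 : ℝ) < 1 by norm_num)
  set M := 5 ^ t with hM
  obtain ⟨q, hq, hqp⟩ := Nat.exists_infinite_primes (2 * M + 1 + ⌈2 / δ⌉₊)
  have : Fact q.Prime := ⟨hqp⟩
  have hq0 : 0 < q := hqp.pos
  have hM0 : 0 < M := by positivity
  let c : Fin M → ZMod q := fun j => ((j + 1 : ℕ) : ZMod q)
  have hc0 : ∀ j, c j ≠ 0 := fun j h => by
    have := Nat.le_of_dvd (Nat.succ_pos _) ((ZMod.natCast_eq_zero_iff _ _).1 h)
    omega
  have hcc : ∀ i j, c i ≠ -c j := fun i j h => by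
    have h' : ((i + 1 + (j + 1) : ℕ) : ZMod q) = 0 := by
      rw [Nat.cast_add]
      exact eq_neg_iff_add_eq_zero.1 h
    have := Nat.le_of_dvd (by omega) ((ZMod.natCast_eq_zero_iff _ _).1 h')
    omega
  have hc : Function.Injective c := fun i j h => by
    have := (ZMod.natCast_eq_natCast_iff' _ _ _).1 h
    rw [Nat.mod_eq_of_lt (by omega), Nat.mod_eq_of_lt (by omega)] at this
    exact Fin.ext (by omega)
  let φ : Fin M ⊕ Fin M → ZMod q := Sum.elim c fun j => -c j
  have hφ0 : ∀ i, φ i ≠ 0 := by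
    rintro (i | i)
    · exact hc0 i
    · exact neg_ne_zero.2 (hc0 i)
  have hφ : ∀ i, φ i.swap = -φ i := by
    rintro (i | i)
    · rfl
    · exact (neg_neg _).symm
  have hinj : Function.Injective φ :=
    hc.sumElim (neg_injective.comp hc) hcc
  refine ⟨2 * M * q ^ 2, by positivity, fun N₀ => ?_⟩
  obtain ⟨π, hπ⟩ := exists_perms_sum_sq_le (N₀ + 1) t
  have hσ : ∀ i, withInverses π i.swap = (withInverses π i)⁻¹ := by
    rintro (i | i)
    · rfl
    · exact (inv_inv _).symm
  refine ⟨_, inferInstance, labelledGraph φ (withInverses π) Sum.swap hφ0 hφ hσ, ?_, ?_, ?_, ?_⟩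
  · simp only [Fintype.card_prod, ZMod.card]
    have : 0 < (N₀ + 1) * (q * q * q) := by positivity
    nlinarith
  · exact Fintype.card_pos
  · intro x
    rw [adjOp_labelledGraph_one hφ0 hφ hσ hinj]
    simp only [Fintype.card_sum, Fintype.card_fin, ZMod.card]
    push_cast
    ring
  · intro f hf
    refine (sum_sq_adjOp_labelledGraph_le hφ0 hφ hσ hinj (sum_sq_sum_withInverses_le π hπ)
      (by positivity) f hf).trans ?_
    refine mul_le_mul_of_nonneg_right ?_ (Finset.sum_nonneg fun x _ => sq_nonneg (f x))
    simp only [Fintype.card_sum, Fintype.card_fin, ZMod.card]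
    have hqδ : 2 ≤ q * δ := by
      rw [← div_le_iff₀ hδ]
      exact (Nat.le_ceil _).trans (by exact_mod_cast (by omega))
    have hqδ2 : 4 ≤ (q * δ) ^ 2 := by nlinarith
    push_cast
    calc 2 * ((q : ℝ) ^ 4 * (4 * (((5 : ℝ) ^ t) ^ 2 * (1199 / 1200) ^ t)) + ((M + M) * q) ^ 2)
        = 8 * q ^ 4 * M ^ 2 * (1199 / 1200) ^ t + 2 * M ^ 2 * q ^ 2 * 4 := by
          rw [hM]
          push_cast
          ring
      _ ≤ 8 * q ^ 4 * M ^ 2 * (δ ^ 2 / 4) + 2 * M ^ 2 * q ^ 2 * (q * δ) ^ 2 := by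
          gcongr
      _ = (2 * M * q ^ 2 * δ) ^ 2 := by ring

theorem exists_blob_graph {D d : ℕ} (hD : 0 < D) (hd : 4 * D ^ 2 + 2 ≤ d) :
    ∃ (W : Type) (_ : Fintype W) (H : SimpleGraph W) (r : ℕ), D * Fintype.card W + r = d ∧
      r < 2 * D ∧ (∀ w, adjOp H (fun _ => 1) w = r) ∧
      TypeBound H (d ^ (2 ^ (4 * D) + 8 * D)) := by
  set h := d / (2 * D) with hh
  have hh2 : 2 * D ≤ h := by
    rw [hh, Nat.le_div_iff_mul_le (by omega)]
    nlinarith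
  set l := (h - 2 * D) / (2 * D) with hl
  set a := (h - 2 * D) % (2 * D) with ha
  have hdiv : 2 * D * l + a = h - 2 * D := Nat.div_add_mod _ _
  have halt : a < 2 * D := Nat.mod_lt _ (by omega)
  set r := d % (2 * D) with hr
  have hdr : 2 * D * h + r = d := Nat.div_add_mod _ _
  have hrlt : r < 2 * D := Nat.mod_lt _ (by omega)
  have : NeZero (2 * D) := ⟨by omega⟩
  have : NeZero (2 * D + a) := ⟨by omega⟩
  refine ⟨_, inferInstance, lexProduct (⊥ : SimpleGraph (Fin l)) (bipartiteCirculant (2 * D) r) ⊕g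
    bipartiteCirculant (2 * D + a) r, r, ?_, hrlt, ?_, ?_⟩
  · simp only [Fintype.card_sum, Fintype.card_prod, Fintype.card_fin, Fintype.card_bool, ZMod.card]
    have : l * (2 * (2 * D)) + 2 * (2 * D + a) = 2 * h := by
      have : 2 * D * l + a + 2 * D = h := by omega
      rw [← this]
      ring
    rw [this, ← hdr]
    ring
  · rintro (⟨i, w⟩ | w)
    · rw [adjOp_sum_inl, adjOp_lexProduct, adjOp_bipartiteCirculant hrlt.le]
      simp [adjOp]
    · rw [adjOp_sum_inr, adjOp_bipartiteCirculant (by omega)]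
  · have h1 := typeBound_lexProduct_bot l (bipartiteCirculant (2 * D) r)
    have h2 := typeBound_two_pow (bipartiteCirculant (2 * D + a) r)
    obtain ⟨T, hT, τ, hcard, hτ⟩ := h1.sum h2
    refine ⟨T, hT, τ, hcard.trans ?_, hτ⟩
    simp only [Fintype.card_prod, Fintype.card_bool, ZMod.card]
    have hlh : l ≤ h - 2 * D := Nat.div_le_self _ _
    have hhd : h ≤ d := Nat.div_le_self _ _
    have hld : l + 1 ≤ d := by omega
    rw [pow_add, show 2 * (2 * D) = 4 * D by ring]
    refine Nat.mul_le_mul (Nat.pow_le_pow_left hld _) ?_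
    exact (Nat.pow_le_pow_left (by omega : 2 ≤ d) _).trans
      (Nat.pow_le_pow_right (by omega) (by omega))

end Assembly

/-- For every `δ > 0` there is `C > 0` such that for every sufficiently large `d` there
are infinitely many `n` admitting an `(n,d,λ)`-graph `G` with `λ/d ≤ δ` having at most
`exp(C n log d / d)` pairwise non-isomorphic induced subgraphs: every family of subsets
of `V(G)` whose induced subgraphs are pairwise non-isomorphic has size at most
`exp(C n log d / d)`. -/
theorem few_nonisomorphic_induced_subgraphs :
    ∀ δ > (0 : ℝ), ∃ C > (0 : ℝ), ∃ d₀ : ℕ, ∀ d : ℕ, d₀ ≤ d →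
      ∀ N₀ : ℕ, ∃ n : ℕ, N₀ ≤ n ∧
        ∃ (lam : ℝ) (G : SimpleGraph (Fin n)),
          IsNDLGraph n d lam G ∧ lam / d ≤ δ ∧
            ∀ (N : ℕ) (f : Fin N → Set (Fin n)),
              (∀ i j : Fin N, i ≠ j →
                IsEmpty (G.induce (f i) ≃g G.induce (f j))) →
              (N : ℝ) ≤ Real.exp (C * n * Real.log d / d) := by
  intro δ hδ
  obtain ⟨D, hD, hbase⟩ := exists_base_graph (half_pos hδ)
  have hD' : (0 : ℝ) < D := Nat.cast_pos.2 hD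
  set E := 2 ^ (4 * D) + 8 * D with hE
  refine ⟨2 * D * E, by positivity, 4 * D ^ 2 + 2 + ⌈4 * D / δ⌉₊, fun d hd N₀ => ?_⟩
  have hd0 : (0 : ℝ) < d := Nat.cast_pos.2 (by omega)
  have hδd : 4 * D ≤ δ * d := by
    rw [← div_le_iff₀' hδ]
    exact (Nat.le_ceil _).trans (Nat.cast_le.2 (by omega))
  obtain ⟨W, _, H, r, hdW, hr, hreg, htype⟩ := exists_blob_graph hD (by omega : 4 * D ^ 2 + 2 ≤ d)
  obtain ⟨V, _, B, hN₀, hV, hBreg, hB⟩ := hbase N₀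
  have hdW' : (D : ℝ) * Fintype.card W + r = d := by exact_mod_cast hdW
  have hr' : (r : ℝ) ≤ 2 * D := by exact_mod_cast hr.le
  have hdW2 : d ≤ 2 * D * Fintype.card W := by nlinarith
  have hW : 0 < Fintype.card W := by
    by_contra h0
    simp only [not_lt, Nat.le_zero] at h0
    rw [h0] at hdW2
    omega
  let e : Fin (Fintype.card (V × W)) ≃ V × W := (Fintype.equivFin _).symm
  have hcard : Fintype.card (V × W) = Fintype.card V * Fintype.card W := Fintype.card_prod V W
  refine ⟨Fintype.card (V × W), ?_, δ * d, (lexProduct B H).comap e, ?_, ?_, ?_⟩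
  · rw [hcard]
    exact hN₀.trans (Nat.le_mul_of_pos_right _ hW)
  · refine isNDLGraph_of_spectralBound (by rw [hcard]; positivity) (by positivity) _ ?_ ?_
    · intro x
      have hsum : adjOp B (fun _ => ∑ _w : W, (1 : ℝ)) (e x).1 = D * Fintype.card W := by
        rw [← hBreg (e x).1]
        simp only [adjOp, Finset.sum_mul]
        exact Finset.sum_congr rfl fun u _ => by simp
      rw [adjOp_comap, ← hdW', ← hsum, ← hreg (e x).2]
      exact adjOp_lexProduct B H (fun _ => 1) _ _
    · refine SpectralBound.comap (hB.lexProduct hreg ?_) e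
      have h1 : (Fintype.card W : ℝ) * (D * (δ / 2)) ≤ δ * d / 2 := by
        rw [← hdW']
        nlinarith [Nat.cast_nonneg (α := ℝ) r]
      have h2 : (r : ℝ) ≤ δ * d / 2 := by linarith
      have h3 := pow_le_pow_left₀ (by positivity) h1 2
      have h4 := pow_le_pow_left₀ (by positivity) h2 2
      linarith
  · exact (mul_div_cancel_right₀ δ hd0.ne').le
  · intro N f hf
    have hN := ((TypeBound.lexProduct (G := B) htype).comap e).card_le f hf
    have hlog : 0 ≤ Real.log d := Real.log_natCast_nonneg d
    have hdW3 : (d : ℝ) ≤ 2 * D * Fintype.card W := by exact_mod_cast hdW2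
    calc (N : ℝ) ≤ (d : ℝ) ^ (E * Fintype.card V) := by
          rw [pow_mul]
          exact_mod_cast hN
      _ = Real.exp (E * Fintype.card V * Real.log d) := by
          rw [← Real.exp_log (pow_pos hd0 _), Real.log_pow]
          push_cast
          rfl
      _ ≤ _ := by
          rw [Real.exp_le_exp, le_div_iff₀ hd0, hcard]
          push_cast
          calc (E : ℝ) * Fintype.card V * Real.log d * d
              ≤ E * Fintype.card V * Real.log d * (2 * D * Fintype.card W) := by gcongr
            _ = _ := by ring
end

section
/- There exists ε₀ > 0 such that for every ε ∈ (0, ε₀) and every constant α ∈ (0, ε⁸) the following holds. For every γ > 0 there exist β > 0 and n₀ ∈ ℕ such that for all n ≥ n₀, all d with 1 + ε ≤ d ≤ β·n, and every (n,d,λ)-graph G with λ/d ≤ α^{2/α}: setting p = (1+ε)/d, with probability at least 1 − γ the random vertex set V_p contains no subset S with |S| = m, α·n/d ≤ m ≤ n/(3d), such that |N_G(S)| < (1−α)·(d·m − d²·m²/(2n)), where N_G(S) = {v ∈ V(G) \ S : v has a neighbour in S} is the external neighbourhood of S in G. -/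
open Finset

open MeasureTheory in
/-- The Bernoulli measure on `Bool` with success probability `p`. -/
noncomputable def bernoulliMeasure (p : ℝ) : Measure Bool :=
  (ENNReal.ofReal p) • Measure.dirac true + (ENNReal.ofReal (1 - p)) • Measure.dirac false

open MeasureTheory in
/-- The site-percolation measure on subsets of `V` (encoded as functions `V → Bool`):
every vertex is retained independently with probability `p`. -/
noncomputable def percolationMeasure (V : Type*) [Fintype V] (p : ℝ) :
    Measure (V → Bool) :=
  Measure.pi fun _ : V => bernoulliMeasure p

/-- The vertex set retained by the percolation outcome `ω`. -/
def percSet {V : Type*} (ω : V → Bool) : Set V := {v : V | ω v = true}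

/-- The external neighbourhood of `S` in `G`. -/
def extNbhd {V : Type*} (G : SimpleGraph V) (S : Set V) : Set V :=
  {v : V | v ∉ S ∧ ∃ u ∈ S, G.Adj u v}

/-- Total weight of all sequences of `m` distinct elements of `S`, where, starting from `U`, appending
`v` costs a factor `c U v` and enlarges `U` to `U ∪ N v`. -/
noncomputable def explorationWeight {V : Type*} [DecidableEq V] (N : V → Finset V)
    (c : Finset V → V → ℝ) : ℕ → Finset V → Finset V → ℝ
  | 0, _, _ => 1
  | m + 1, U, S => ∑ v ∈ S, c U v * explorationWeight N c m (U ∪ N v) (S.erase v)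

lemma explorationWeight_nonneg {V : Type*} [DecidableEq V] {N : V → Finset V}
    {c : Finset V → V → ℝ} (hc : ∀ U v, 0 ≤ c U v) (m : ℕ) (U S : Finset V) :
    0 ≤ explorationWeight N c m U S := by
  induction m generalizing U S with
  | zero => simp [explorationWeight]
  | succ m ih => exact sum_nonneg fun v _ => mul_nonneg (hc U v) (ih _ _)

lemma sum_explorationWeight_le {V : Type*} [Fintype V] [DecidableEq V] {N : V → Finset V}
    {c : Finset V → V → ℝ} {K : ℝ} (hc : ∀ U v, 0 ≤ c U v) (hK : ∀ U, ∑ v, c U v ≤ K)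
    (m : ℕ) (U : Finset V) :
    ∑ S ∈ powersetCard m univ, explorationWeight N c m U S ≤ K ^ m := by
  induction m generalizing U with
  | zero => simp [explorationWeight]
  | succ m ih =>
    have hK0 : 0 ≤ K := (sum_nonneg fun v _ => hc U v).trans (hK U)
    calc ∑ S ∈ powersetCard (m + 1) univ, explorationWeight N c (m + 1) U S
        = ∑ v, ∑ S ∈ (powersetCard (m + 1) univ).filter (v ∈ ·),
            c U v * explorationWeight N c m (U ∪ N v) (S.erase v) := by
          simp only [explorationWeight]
          exact sum_comm' (by simp)
      _ ≤ ∑ v, c U v * K ^ m := by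
          refine sum_le_sum fun v _ => ?_
          rw [← mul_sum]
          refine mul_le_mul_of_nonneg_left (le_trans ?_ (ih (U ∪ N v))) (hc U v)
          have hinj : Set.InjOn (fun S : Finset V => S.erase v)
              ((powersetCard (m + 1) univ).filter (v ∈ ·) : Finset (Finset V)) := by
            intro S hS T hT h
            simp only [coe_filter, Set.mem_ofPred_eq] at hS hT
            rw [← insert_erase hS.2, ← insert_erase hT.2]
            exact congrArg (insert v) h
          rw [← sum_image (f := explorationWeight N c m (U ∪ N v)) hinj]
          refine sum_le_sum_of_subset_of_nonneg ?_ fun S _ _ => explorationWeight_nonneg hc _ _ _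
          intro S hS
          obtain ⟨T, hT, rfl⟩ := mem_image.1 hS
          simp only [mem_filter, mem_powersetCard_univ] at hT
          simp [card_erase_of_mem hT.2, hT.1]
      _ = (∑ v, c U v) * K ^ m := by rw [sum_mul]
      _ ≤ K ^ (m + 1) := by
          rw [pow_succ']; exact mul_le_mul_of_nonneg_right (hK U) (by positivity)

lemma le_explorationWeight {V : Type*} [Fintype V] [DecidableEq V] {N : V → Finset V}
    {c : Finset V → V → ℝ} {x D n δ : ℝ} (hx : 1 ≤ x) (hD : 0 < D) (hDn : D ≤ n) (hδ : 0 ≤ δ)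
    (hn : n = Fintype.card V) (hN : ∀ v, ((N v).card : ℝ) = D)
    (hc : ∀ U v, c U v = if D * U.card / n + δ * D < ((N v ∩ U).card : ℝ) then x else 1)
    (m : ℕ) (U S : Finset V) (hS : S.card = m) :
    (m.factorial : ℝ) *
        x ^ ((n - (U ∪ S.biUnion N).card - (n - U.card) * (1 - D / n) ^ m) / D - δ * m) ≤
      explorationWeight N c m U S := by
  have hx0 : 0 < x := by linarith
  have hn0 : 0 < n := by linarith
  induction m generalizing U S with
  | zero =>
    rw [card_eq_zero.1 hS]
    simp [explorationWeight]
  | succ m ih =>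
    have hq0 : 0 ≤ 1 - D / n := by rw [sub_nonneg, div_le_one hn0]; exact hDn
    have hq1 : (1 - D / n) ^ m ≤ 1 := pow_le_one₀ hq0 (by linarith [div_pos hD hn0])
    have hqm : 0 ≤ (1 - D / n) ^ m := pow_nonneg hq0 m
    have key : ∀ v ∈ S, (m.factorial : ℝ) *
        x ^ ((n - (U ∪ S.biUnion N).card - (n - U.card) * (1 - D / n) ^ (m + 1)) / D
          - δ * (m + 1 : ℕ)) ≤ c U v * explorationWeight N c m (U ∪ N v) (S.erase v) := by
      intro v hv
      have h1 := ih (U ∪ N v) (S.erase v) (by rw [card_erase_of_mem hv, hS]; rfl)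
      have hU : U ∪ N v ∪ (S.erase v).biUnion N = U ∪ S.biUnion N := by
        conv_rhs => rw [← insert_erase hv, biUnion_insert]
        rw [union_assoc]
      rw [hU] at h1
      have hcard : ((U ∪ N v).card : ℝ) = U.card + D - (N v ∩ U).card := by
        rw [← hN v, inter_comm]
        have := card_union_add_card_inter U (N v)
        rw [eq_sub_iff_add_eq]; exact_mod_cast this
      have hUn : (U.card : ℝ) ≤ n := by rw [hn]; exact_mod_cast card_le_univ U
      have hint : ((N v ∩ U).card : ℝ) ≤ D := by
        rw [← hN v]; exact_mod_cast card_le_card inter_subset_left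
      obtain ⟨a, ha, hca, hr⟩ : ∃ a : ℝ, 0 ≤ a ∧ c U v = x ^ a ∧
          n - ((U ∪ N v).card : ℝ) ≤ (n - U.card) * (1 - D / n) + (δ * D + D * a) := by
        have hexp : (n - (U.card : ℝ)) * (1 - D / n) = n - U.card - D + D * U.card / n := by
          field_simp; ring
        have hpos : 0 ≤ D * U.card / n := by positivity
        rw [hc, hexp, hcard]
        split_ifs with h
        · exact ⟨1, zero_le_one, by simp, by nlinarith⟩
        · exact ⟨0, le_rfl, by simp, by linarith⟩
      rw [hca]
      refine le_trans ?_ (mul_le_mul_of_nonneg_left h1 (by positivity))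
      rw [mul_left_comm, ← Real.rpow_add hx0]
      refine mul_le_mul_of_nonneg_left (Real.rpow_le_rpow_of_exponent_le hx ?_) (by positivity)
      have h2 : (n - ((U ∪ N v).card : ℝ)) * (1 - D / n) ^ m ≤
          (n - U.card) * (1 - D / n) ^ (m + 1) + (δ * D + D * a) := by
        calc _ ≤ ((n - U.card) * (1 - D / n) + (δ * D + D * a)) * (1 - D / n) ^ m :=
              mul_le_mul_of_nonneg_right hr hqm
          _ ≤ _ := by
              have : 0 ≤ δ * D + D * a := by positivity
              rw [pow_succ]
              nlinarith
      push_cast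
      have h3 : (n - (U ∪ S.biUnion N).card - (n - U.card) * (1 - D / n) ^ (m + 1)) / D ≤
          (n - (U ∪ S.biUnion N).card - (n - ((U ∪ N v).card : ℝ)) * (1 - D / n) ^ m) / D
            + (δ + a) := by
        rw [div_add' _ _ _ hD.ne']
        gcongr
        linarith
      linarith
    calc _ = ∑ v ∈ S, (m.factorial : ℝ) *
        x ^ ((n - (U ∪ S.biUnion N).card - (n - U.card) * (1 - D / n) ^ (m + 1)) / D
          - δ * (m + 1 : ℕ)) := by
          rw [sum_const, hS, Nat.factorial_succ]; push_cast; rw [nsmul_eq_mul]; push_cast; ring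
      _ ≤ _ := sum_le_sum key

lemma Matrix.IsHermitian.sum_sq_mulVec_le {n : ℕ} {A : Matrix (Fin n) (Fin n) ℝ}
    (hA : A.IsHermitian) {i₀ : Fin n} {D L : ℝ} (hL : L < D)
    (h1 : A.mulVec (fun _ => 1) = fun _ => D) (hev : ∀ i ≠ i₀, |hA.eigenvalues i| ≤ L)
    (x : Fin n → ℝ) (hx : ∑ v, x v = 0) :
    ∑ v, (A.mulVec x v) ^ 2 ≤ L ^ 2 * ∑ v, x v ^ 2 := by
  have hdot : ∀ (i : Fin n) (y : Fin n → ℝ),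
      dotProduct (hA.eigenvectorBasis i) (A.mulVec y) =
        hA.eigenvalues i * dotProduct (hA.eigenvectorBasis i) y := by
    intro i y
    have hT : A.transpose = A := by simpa [Matrix.IsSymm] using hA
    have := hA.mulVec_eigenvectorBasis i
    rw [Matrix.dotProduct_mulVec, ← Matrix.mulVec_transpose, hT, this, smul_dotProduct,
      smul_eq_mul]
  have hparseval : ∀ y : Fin n → ℝ,
      ∑ i, (dotProduct (hA.eigenvectorBasis i) y) ^ 2 = ∑ v, y v ^ 2 := by
    intro y
    have := hA.eigenvectorBasis.sum_sq_norm_inner_right (WithLp.toLp 2 y)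
    simpa [EuclideanSpace.norm_sq_eq, EuclideanSpace.inner_eq_star_dotProduct,
      dotProduct_comm] using this
  have hone : ∀ i ≠ i₀, dotProduct (hA.eigenvectorBasis i) (fun _ => (1 : ℝ)) = 0 := by
    intro i hi
    have h := hdot i (fun _ => 1)
    rw [h1, show (fun _ : Fin n => D) = D • (fun _ : Fin n => (1 : ℝ)) by ext; simp,
      dotProduct_smul, smul_eq_mul] at h
    have hne : D - hA.eigenvalues i ≠ 0 := by
      have := le_abs_self (hA.eigenvalues i)
      have := hev i hi
      intro h0; linarith
    exact (mul_eq_zero.1 (show (D - hA.eigenvalues i) * _ = 0 by rw [sub_mul, h, sub_self])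
      ).resolve_left hne
  have hzero : dotProduct (hA.eigenvectorBasis i₀) x = 0 := by
    have hp : ∑ i, dotProduct (hA.eigenvectorBasis i) (fun _ => (1 : ℝ)) *
        dotProduct (hA.eigenvectorBasis i) x = ∑ v, x v := by
      have := hA.eigenvectorBasis.sum_inner_mul_inner (WithLp.toLp 2 fun _ => (1 : ℝ))
        (WithLp.toLp 2 x)
      simpa [EuclideanSpace.inner_eq_star_dotProduct, dotProduct, mul_comm] using this
    rw [hx, sum_eq_single i₀ (fun i _ hi => by rw [hone i hi, zero_mul]) (by simp)] at hp
    refine (mul_eq_zero.1 hp).resolve_left fun h0 => ?_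
    have h2 := hparseval (fun _ => 1)
    rw [sum_eq_zero fun i _ => by
      by_cases hi : i = i₀
      · rw [hi, h0]; simp
      · rw [hone i hi]; simp] at h2
    have : n = 0 := by simpa using h2.symm
    exact absurd i₀.2 (by omega)
  rw [← hparseval x, ← hparseval (A.mulVec x), mul_sum]
  refine sum_le_sum fun i _ => ?_
  rw [hdot, mul_pow]
  by_cases hi : i = i₀
  · rw [hi, hzero]; simp
  · exact mul_le_mul_of_nonneg_right (sq_le_sq' (abs_le.1 (hev i hi)).1 (abs_le.1 (hev i hi)).2)
      (sq_nonneg _)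

lemma sum_sq_card_inter_le {n d : ℕ} {G : SimpleGraph (Fin n)} [DecidableRel G.Adj]
    (hG : G.IsRegularOfDegree d) (hA : (G.adjMatrix ℝ).IsHermitian) {i₀ : Fin n} {L : ℝ}
    (hL : L < d) (hev : ∀ i ≠ i₀, |hA.eigenvalues i| ≤ L) (U : Finset (Fin n)) :
    ∑ v, (((G.neighborFinset v ∩ U).card : ℝ) - d * U.card / n) ^ 2 ≤ L ^ 2 * U.card := by
  have hn : (n : ℝ) ≠ 0 := by exact_mod_cast (Fin.pos i₀).ne'
  have hsum : ∑ v, (if v ∈ U then (1 : ℝ) else 0) = U.card := by simp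
  have h := hA.sum_sq_mulVec_le (D := d) hL
    (by ext v; simp [hG.degree_eq v]) hev
    (fun v => (if v ∈ U then (1 : ℝ) else 0) - U.card / n)
    (by rw [sum_sub_distrib, hsum]; simp; field_simp; simp)
  have hmul : ∀ v, (G.adjMatrix ℝ).mulVec
      (fun v => (if v ∈ U then (1 : ℝ) else 0) - U.card / n) v =
        ((G.neighborFinset v ∩ U).card : ℝ) - d * U.card / n := by
    intro v
    rw [SimpleGraph.adjMatrix_mulVec_apply, sum_sub_distrib, sum_const,
      SimpleGraph.card_neighborFinset_eq_degree, hG.degree_eq v]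
    simp [mul_div_assoc]
  simp only [hmul] at h
  refine h.trans (mul_le_mul_of_nonneg_left ?_ (sq_nonneg L))
  have : ∀ v : Fin n, ((if v ∈ U then (1 : ℝ) else 0) - U.card / n) ^ 2 =
      (if v ∈ U then (1 : ℝ) else 0) * (1 - 2 * (U.card / n)) + ((U.card : ℝ) / n) ^ 2 := by
    intro v; split_ifs <;> ring
  simp only [this]
  rw [sum_add_distrib, ← sum_mul, hsum]
  simp only [sum_const, card_univ, Fintype.card_fin, nsmul_eq_mul]
  have h2 : (U.card : ℝ) * (1 - 2 * (U.card / n)) + n * ((U.card : ℝ) / n) ^ 2 =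
    U.card - (U.card : ℝ) ^ 2 / n := by field_simp; ring
  rw [h2]
  have : 0 ≤ (U.card : ℝ) ^ 2 / n := by positivity
  linarith

lemma card_atypical_le {n d : ℕ} {G : SimpleGraph (Fin n)} [DecidableRel G.Adj]
    (hG : G.IsRegularOfDegree d) (hA : (G.adjMatrix ℝ).IsHermitian) {i₀ : Fin n} {θ δ : ℝ}
    (hd : 0 < d) (hθ : θ < 1) (hδ : 0 < δ) (hev : ∀ i ≠ i₀, |hA.eigenvalues i| ≤ θ * d)
    (U : Finset (Fin n)) :
    ((univ.filter fun v => (d : ℝ) * U.card / n + δ * d < ((G.neighborFinset v ∩ U).card : ℝ)).card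
      : ℝ) ≤ (θ / δ) ^ 2 * n := by
  have hd' : (0 : ℝ) < d := by exact_mod_cast hd
  have h := sum_sq_card_inter_le hG hA (by nlinarith) hev U
  have hU : (U.card : ℝ) ≤ n := by simpa using card_le_univ U
  set F := univ.filter fun v => (d : ℝ) * U.card / n + δ * d < ((G.neighborFinset v ∩ U).card : ℝ)
  have h1 : (F.card : ℝ) * (δ * d) ^ 2 ≤ (θ * d) ^ 2 * n := by
    calc (F.card : ℝ) * (δ * d) ^ 2 = ∑ v ∈ F, (δ * d) ^ 2 := by simp
      _ ≤ ∑ v ∈ F, (((G.neighborFinset v ∩ U).card : ℝ) - d * U.card / n) ^ 2 := by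
          refine sum_le_sum fun v hv => ?_
          have := (mem_filter.1 hv).2
          exact pow_le_pow_left₀ (by positivity) (by linarith) 2
      _ ≤ ∑ v, (((G.neighborFinset v ∩ U).card : ℝ) - d * U.card / n) ^ 2 :=
          sum_le_sum_of_subset_of_nonneg (subset_univ _) fun _ _ _ => sq_nonneg _
      _ ≤ (θ * d) ^ 2 * U.card := h
      _ ≤ _ := by gcongr
  rw [← mul_le_mul_iff_left₀ (show 0 < (δ * d) ^ 2 by positivity)]
  refine h1.trans (le_of_eq ?_)
  field_simp

lemma one_le_mul_degree {n d : ℕ} {G : SimpleGraph (Fin n)} [DecidableRel G.Adj]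
    (hG : G.IsRegularOfDegree d) (hA : (G.adjMatrix ℝ).IsHermitian) {i₀ : Fin n} {θ : ℝ}
    (hd : 0 < d) (hdn : 2 * d ≤ n) (hθ : θ < 1) (hev : ∀ i ≠ i₀, |hA.eigenvalues i| ≤ θ * d) :
    1 ≤ 4 * θ ^ 2 * d := by
  have hd' : (0 : ℝ) < d := by exact_mod_cast hd
  have hn : (0 : ℝ) < n := by exact_mod_cast (Fin.pos i₀)
  have hdn' : 2 * (d : ℝ) ≤ n := by exact_mod_cast hdn
  have h := sum_sq_card_inter_le hG hA (by nlinarith) hev {i₀}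
  have h1 : (d : ℝ) * (1 / 2) ^ 2 ≤ (θ * d) ^ 2 := by
    calc (d : ℝ) * (1 / 2) ^ 2 = ∑ v ∈ G.neighborFinset i₀, (1 / 2) ^ 2 := by
          simp [hG.degree_eq i₀]
      _ ≤ ∑ v ∈ G.neighborFinset i₀,
            (((G.neighborFinset v ∩ {i₀}).card : ℝ) - d * ({i₀} : Finset (Fin n)).card / n) ^ 2 := by
          refine sum_le_sum fun v hv => ?_
          have hv' : i₀ ∈ G.neighborFinset v := by
            rw [SimpleGraph.mem_neighborFinset] at hv ⊢; exact hv.symm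
          rw [inter_singleton_of_mem hv']
          have : (d : ℝ) / n ≤ 1 / 2 := by rw [div_le_div_iff₀ hn two_pos]; linarith
          simp only [card_singleton, Nat.cast_one, mul_one]
          exact pow_le_pow_left₀ (by positivity) (by linarith) 2
      _ ≤ _ := sum_le_sum_of_subset_of_nonneg (subset_univ _) fun _ _ _ => sq_nonneg _
      _ ≤ _ := by simpa using h
  nlinarith

lemma one_sub_pow_le_quadratic {q : ℝ} (h0 : 0 ≤ q) (h1 : q ≤ 1) (m : ℕ) :
    (1 - q) ^ m ≤ 1 - q * m + (q * m) ^ 2 / 2 := by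
  induction m with
  | zero => simp
  | succ m ih =>
    have := mul_le_mul_of_nonneg_right ih (sub_nonneg.2 h1)
    have h2 : 0 ≤ q * (q * m) ^ 2 := by positivity
    rw [pow_succ]; push_cast
    nlinarith [sq_nonneg q]

lemma rpow_two_div_bounds {α : ℝ} (h0 : 0 < α) (h1 : α < 1 / 65536) :
    0 < α ^ (2 / α) ∧ α ^ (2 / α) ≤ α ^ 2 := by
  refine ⟨by positivity, ?_⟩
  rw [← Real.rpow_natCast α 2]
  refine Real.rpow_le_rpow_of_exponent_ge h0 (by linarith) ?_
  rw [le_div_iff₀ h0]; push_cast; nlinarith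

lemma union_bound_base_le {α ε : ℝ} (h0 : 0 < α) (h1 : α < 1 / 65536) (hε0 : 0 < ε)
    (hε1 : ε < 1 / 4) :
    2 * Real.exp 1 * (1 + ε) / α ≤
      1 / 2 * (((α / 6 / α ^ (2 / α)) ^ 2) ^ (α / 2)) := by
  have hθ := (rpow_two_div_bounds h0 h1).1
  have h2 : ((α / 6 / α ^ (2 / α)) ^ 2) ^ (α / 2) = (α / 6) ^ α / α ^ 2 := by
    rw [← Real.rpow_natCast (_ / _) 2, ← Real.rpow_mul (by positivity),
      Real.div_rpow (by positivity) (by positivity), Nat.cast_two, mul_div_cancel₀ α two_ne_zero,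
      ← Real.rpow_mul h0.le, div_mul_cancel₀ _ h0.ne', Real.rpow_two]
  have h3 : Real.sqrt (α / 6) ≤ (α / 6) ^ α := by
    rw [Real.sqrt_eq_rpow]
    exact Real.rpow_le_rpow_of_exponent_ge (by positivity) (by linarith) (by linarith)
  have h4 : 14 * α ≤ Real.sqrt (α / 6) := by
    refine Real.le_sqrt_of_sq_le ?_
    nlinarith
  have h5 : Real.exp 1 < 2.72 := by linarith [Real.exp_one_lt_d9]
  rw [h2, ← mul_div_assoc, div_le_div_iff₀ h0 (by positivity)]
  have h6 : 2 * Real.exp 1 * (1 + ε) ≤ 7 := by nlinarith [Real.exp_pos 1]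
  have h7 : 2 * Real.exp 1 * (1 + ε) * α ≤ 1 / 2 * (α / 6) ^ α := by nlinarith
  nlinarith

/-- `S` has size between `α n / d` and `n / (3 d)`, and its external neighbourhood is smaller than
`(1 - α) (d |S| - d² |S|² / (2 n))`. -/
def HasSmallNbhd {n : ℕ} (G : SimpleGraph (Fin n)) (d : ℕ) (α : ℝ) (S : Finset (Fin n)) : Prop :=
  α * n / d ≤ (S.card : ℝ) ∧ (S.card : ℝ) ≤ (n : ℝ) / (3 * d) ∧
    ((extNbhd G (S : Set (Fin n))).ncard : ℝ) <
      (1 - α) * (d * S.card - d ^ 2 * (S.card : ℝ) ^ 2 / (2 * n))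

lemma card_biUnion_neighborFinset_le {n : ℕ} (G : SimpleGraph (Fin n)) [DecidableRel G.Adj]
    (S : Finset (Fin n)) :
    ((S.biUnion fun v => G.neighborFinset v).card : ℝ) ≤
      (extNbhd G (S : Set (Fin n))).ncard + S.card := by
  have hsub : ((S.biUnion fun v => G.neighborFinset v : Finset (Fin n)) : Set (Fin n)) ⊆
      extNbhd G (S : Set (Fin n)) ∪ (S : Set (Fin n)) := by
    intro w hw
    simp only [coe_biUnion, Set.mem_iUnion, mem_coe, SimpleGraph.mem_neighborFinset] at hw
    obtain ⟨u, hu, huw⟩ := hw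
    by_cases h : w ∈ S
    · exact Or.inr h
    · exact Or.inl ⟨h, u, hu, huw⟩
  have h1 := Set.ncard_le_ncard hsub (Set.toFinite _)
  have h2 := Set.ncard_union_le (extNbhd G (S : Set (Fin n))) (S : Set (Fin n))
  rw [Set.ncard_coe_finset] at h1 h2
  exact_mod_cast h1.trans h2

lemma HasSmallNbhd.exponent_ge {n d : ℕ} {G : SimpleGraph (Fin n)} [DecidableRel G.Adj] {α : ℝ}
    {S : Finset (Fin n)} (hS : HasSmallNbhd G d α S) (hα : 0 < α) (hn : 0 < n)
    (hdn : d ≤ n) (hdα : 6 ≤ α * d) :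
    α / 2 * S.card ≤
      (n - (S.biUnion fun v => G.neighborFinset v).card - n * (1 - d / n : ℝ) ^ S.card) / d
        - α / 6 * S.card := by
  have hn' : (0 : ℝ) < n := by exact_mod_cast hn
  have hd' : (0 : ℝ) < d := by
    rcases (Nat.cast_nonneg d : (0 : ℝ) ≤ d).eq_or_lt with h | h
    · rw [← h] at hdα; norm_num at hdα
    · exact h
  obtain ⟨-, h2, h3⟩ := hS
  have h4 := card_biUnion_neighborFinset_le G S
  have h5 := one_sub_pow_le_quadratic (q := d / n) (by positivity)
    ((div_le_one hn').2 (by exact_mod_cast hdn)) S.card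
  generalize ((S.biUnion fun v => G.neighborFinset v).card : ℝ) = b at *
  generalize ((extNbhd G (S : Set (Fin n))).ncard : ℝ) = e at *
  set m : ℝ := (S.card : ℝ)
  have hm : 0 ≤ m := Nat.cast_nonneg _
  have h6 : n * (1 - d / n : ℝ) ^ S.card ≤ n - d * m + d ^ 2 * m ^ 2 / (2 * n) := by
    refine (mul_le_mul_of_nonneg_left h5 hn'.le).trans (le_of_eq ?_)
    field_simp
  have h7 : d ^ 2 * m ^ 2 / (2 * n) ≤ d * m / 6 := by
    rw [le_div_iff₀ (by positivity)] at h2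
    rw [div_le_div_iff₀ (by positivity) (by norm_num)]
    nlinarith [mul_nonneg hd'.le hm]
  rw [le_sub_iff_add_le, le_div_iff₀ hd']
  have h8 : 6 * m ≤ α * d * m := mul_le_mul_of_nonneg_right hdα hm
  have h9 : α * (d ^ 2 * m ^ 2 / (2 * n)) ≤ α * (d * m / 6) :=
    mul_le_mul_of_nonneg_left h7 hα.le
  linarith

open Classical in
lemma card_hasSmallNbhd_mul_pow_le {n d : ℕ} {G : SimpleGraph (Fin n)} [DecidableRel G.Adj]
    (hG : G.IsRegularOfDegree d) (hA : (G.adjMatrix ℝ).IsHermitian) {i₀ : Fin n} {α ε : ℝ}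
    (hd : 0 < d) (hdn : 2 * d ≤ n) (hα0 : 0 < α) (hα1 : α < 1 / 65536)
    (hε0 : 0 < ε) (hε1 : ε < 1 / 4)
    (hev : ∀ i ≠ i₀, |hA.eigenvalues i| ≤ α ^ (2 / α) * d) (m : ℕ) :
    ((powersetCard m univ).filter (HasSmallNbhd G d α)).card * ((1 + ε) / d) ^ m ≤
      (1 / 2 : ℝ) ^ m := by
  have hn : 0 < n := Fin.pos i₀
  have hn' : (0 : ℝ) < n := by exact_mod_cast hn
  have hd' : (0 : ℝ) < d := by exact_mod_cast hd
  obtain ⟨hθ0, hθ1⟩ := rpow_two_div_bounds hα0 hα1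
  have hbase := union_bound_base_le hα0 hα1 hε0 hε1
  set θ := α ^ (2 / α)
  have hθα : θ ≤ α / 6 := by nlinarith
  have hdeg : 6 ≤ α * d := by
    have := one_le_mul_degree hG hA hd hdn (by nlinarith) hev
    have h1 : θ ^ 2 ≤ (α ^ 2) ^ 2 := pow_le_pow_left₀ hθ0.le hθ1 2
    have h2 : 4 * (α ^ 2) ^ 2 ≤ α / 6 := by
      have : α ^ 3 ≤ 1 / 24 := (pow_le_pow_left₀ hα0.le hα1.le 3).trans (by norm_num)
      nlinarith
    have h3 : 4 * θ ^ 2 * d ≤ α / 6 * d := by gcongr; linarith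
    linarith
  set x := (α / 6 / θ) ^ 2
  have hx : 1 ≤ x := one_le_pow₀ ((one_le_div hθ0).2 hθα)
  set F := (powersetCard m univ).filter (HasSmallNbhd G d α)
  rcases F.eq_empty_or_nonempty with hF | hF
  · rw [hF]; simp
  let N : Fin n → Finset (Fin n) := fun v => G.neighborFinset v
  let c : Finset (Fin n) → Fin n → ℝ := fun U v =>
    if d * U.card / n + α / 6 * d < ((N v ∩ U).card : ℝ) then x else 1
  have hc : ∀ U v, 0 ≤ c U v := by
    intro U v; simp only [c]; split_ifs <;> linarith
  have hK : ∀ U, ∑ v, c U v ≤ 2 * n := by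
    intro U
    have h1 := card_atypical_le hG hA hd (by nlinarith) (by positivity : 0 < α / 6) hev U
    simp only [c, N]
    rw [sum_ite, sum_const, sum_const, nsmul_eq_mul, nsmul_eq_mul, mul_one]
    have h2 := mul_le_mul_of_nonneg_right h1 (by linarith : 0 ≤ x)
    have h3 : (θ / (α / 6)) ^ 2 * n * x = n := by simp only [x]; field_simp
    have h4 := card_le_univ (univ.filter fun v =>
      ¬ (d : ℝ) * U.card / n + α / 6 * d < ((G.neighborFinset v ∩ U).card : ℝ))
    rw [Fintype.card_fin] at h4
    have h5 : ((univ.filter fun v => ¬ (d : ℝ) * U.card / n + α / 6 * d <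
      ((G.neighborFinset v ∩ U).card : ℝ)).card : ℝ) ≤ n := by exact_mod_cast h4
    linarith
  have hlow : ∀ S ∈ F, (m.factorial : ℝ) * (x ^ (α / 2)) ^ m ≤ explorationWeight N c m ∅ S := by
    intro S hS
    obtain ⟨hSm, hSb⟩ := mem_filter.1 hS
    rw [mem_powersetCard_univ] at hSm
    refine le_trans ?_ (le_explorationWeight (x := x) (D := d) (n := n) (δ := α / 6) hx hd'
      (by exact_mod_cast (by omega : d ≤ n)) (by positivity) (by simp)
      (fun v => by simp [N, hG.degree_eq v]) (fun U v => rfl) m ∅ S hSm)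
    refine mul_le_mul_of_nonneg_left ?_ (by positivity)
    rw [← Real.rpow_mul_natCast (by linarith)]
    refine Real.rpow_le_rpow_of_exponent_le hx ?_
    have := hSb.exponent_ge hα0 hn (by omega) hdeg
    rw [hSm] at this
    simpa [N] using this
  have hcount : F.card * ((m.factorial : ℝ) * (x ^ (α / 2)) ^ m) ≤ (2 * n) ^ m := by
    calc F.card * ((m.factorial : ℝ) * (x ^ (α / 2)) ^ m)
        = ∑ S ∈ F, (m.factorial : ℝ) * (x ^ (α / 2)) ^ m := by simp
      _ ≤ ∑ S ∈ F, explorationWeight N c m ∅ S := sum_le_sum hlow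
      _ ≤ ∑ S ∈ powersetCard m univ, explorationWeight N c m ∅ S :=
          sum_le_sum_of_subset_of_nonneg (filter_subset _ _) fun S _ _ =>
            explorationWeight_nonneg hc _ _ _
      _ ≤ _ := sum_explorationWeight_le hc hK m ∅
  have hm : α * n / d ≤ m := by
    obtain ⟨S, hS⟩ := hF
    obtain ⟨hSm, hSb⟩ := mem_filter.1 hS
    rw [mem_powersetCard_univ] at hSm
    rw [← hSm]; exact hSb.1
  have hm0 : (0 : ℝ) < m := lt_of_lt_of_le (by positivity) hm
  have hfact : (m : ℝ) ^ m ≤ Real.exp 1 ^ m * m.factorial := by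
    have := Real.pow_div_factorial_le_exp (m : ℝ) hm0.le m
    rw [div_le_iff₀ (by positivity)] at this
    rwa [← Real.exp_nat_mul, mul_one]
  set y := x ^ (α / 2)
  have hy : 0 < y := Real.rpow_pos_of_pos (by linarith) _
  have h1 : 2 * Real.exp 1 * (n * ((1 + ε) / d)) ≤ 1 / 2 * (m * y) := by
    have : n * ((1 + ε) / d) ≤ (1 + ε) / α * m := by
      have h2 : n * ((1 + ε) / d) = (1 + ε) / α * (α * n / d) := by field_simp
      rw [h2]; gcongr
    calc 2 * Real.exp 1 * (n * ((1 + ε) / d)) ≤ 2 * Real.exp 1 * ((1 + ε) / α * m) := by gcongr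
      _ = (2 * Real.exp 1 * (1 + ε) / α) * m := by ring
      _ ≤ (1 / 2 * y) * m := by gcongr
      _ = _ := by ring
  refine le_of_mul_le_mul_right ?_ (show 0 < (m * y) ^ m by positivity)
  calc F.card * ((1 + ε) / d) ^ m * (m * y) ^ m
      = F.card * ((m : ℝ) ^ m * y ^ m) * ((1 + ε) / d) ^ m := by rw [mul_pow]; ring
    _ ≤ F.card * ((Real.exp 1 ^ m * m.factorial) * y ^ m) * ((1 + ε) / d) ^ m := by gcongr
    _ = F.card * (m.factorial * y ^ m) * (Real.exp 1 ^ m * ((1 + ε) / d) ^ m) := by ring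
    _ ≤ (2 * n) ^ m * (Real.exp 1 ^ m * ((1 + ε) / d) ^ m) := by gcongr
    _ = (2 * Real.exp 1 * (n * ((1 + ε) / d))) ^ m := by simp only [← mul_pow]; ring_nf
    _ ≤ (1 / 2 * (m * y)) ^ m := by gcongr
    _ = _ := by rw [mul_pow]

lemma isProbabilityMeasure_bernoulliMeasure {p : ℝ} (h0 : 0 ≤ p) (h1 : p ≤ 1) :
    MeasureTheory.IsProbabilityMeasure (bernoulliMeasure p) := by
  constructor
  simp only [bernoulliMeasure, MeasureTheory.Measure.coe_add, MeasureTheory.Measure.coe_smul,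
    Pi.add_apply, Pi.smul_apply, MeasureTheory.measure_univ, smul_eq_mul, mul_one]
  rw [← ENNReal.ofReal_add h0 (by linarith)]
  simp

lemma percolationMeasure_forall_mem {V : Type*} [Fintype V] [DecidableEq V] {p : ℝ} (h0 : 0 ≤ p)
    (h1 : p ≤ 1) (S : Finset V) :
    percolationMeasure V p {ω | ∀ v ∈ S, ω v = true} = ENNReal.ofReal (p ^ S.card) := by
  have := isProbabilityMeasure_bernoulliMeasure h0 h1
  have hset : {ω : V → Bool | ∀ v ∈ S, ω v = true} =
      Set.pi Set.univ fun v => if v ∈ S then {true} else Set.univ := by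
    ext ω
    simp only [Set.mem_ofPred_eq, Set.mem_pi, Set.mem_univ, true_imp_iff]
    refine forall_congr' fun v => ?_
    by_cases h : v ∈ S <;> simp [h]
  have hv : ∀ v, bernoulliMeasure p (if v ∈ S then {true} else Set.univ) =
      if v ∈ S then ENNReal.ofReal p else 1 := by
    intro v
    split_ifs
    · simp [bernoulliMeasure]
    · exact MeasureTheory.measure_univ
  rw [hset, percolationMeasure, MeasureTheory.Measure.pi_pi]
  simp only [hv]
  rw [prod_ite_mem, univ_inter, prod_const, ENNReal.ofReal_pow h0]

lemma sum_half_pow_filter_le (K M : ℕ) :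
    ∑ m ∈ (range M).filter (K ≤ ·), (1 / 2 : ℝ) ^ m ≤ 2 * (1 / 2) ^ K := by
  calc ∑ m ∈ (range M).filter (K ≤ ·), (1 / 2 : ℝ) ^ m
      ≤ ∑ m ∈ (range M).image (K + ·), (1 / 2 : ℝ) ^ m := by
        refine sum_le_sum_of_subset_of_nonneg (fun m hm => ?_) fun _ _ _ => by positivity
        obtain ⟨h1, h2⟩ := mem_filter.1 hm
        rw [mem_range] at h1
        exact mem_image.2 ⟨m - K, mem_range.2 (by omega), by omega⟩
    _ = (1 / 2) ^ K * ∑ m ∈ range M, (1 / 2 : ℝ) ^ m := by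
        rw [sum_image (fun a _ b _ h => by simpa using h), mul_sum]
        simp [pow_add]
    _ ≤ (1 / 2) ^ K * 2 := by
        gcongr
        exact sum_geometric_two_le M
    _ = _ := mul_comm _ _

/-- There is `ε₀ > 0` such that for every `ε ∈ (0, ε₀)` and every `α ∈ (0, ε⁸)` the
following holds: for every `γ > 0` there are `β > 0` and `n₀` such that for all
`n ≥ n₀`, all `d` with `1 + ε ≤ d ≤ β n`, and every `(n,d,λ)`-graph `G` with
`λ/d ≤ α^{2/α}`, with probability at least `1 - γ` the percolated vertex set contains
no subset `S` with `α n / d ≤ |S| ≤ n/(3d)` and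
`|N_G(S)| < (1-α)(d|S| - d²|S|²/(2n))`. -/
theorem percolated_sets_expand :
    ∃ ε₀ > (0 : ℝ), ∀ ε : ℝ, 0 < ε → ε < ε₀ → ∀ α : ℝ, 0 < α → α < ε ^ 8 →
      ∀ γ > (0 : ℝ), ∃ β > (0 : ℝ), ∃ n₀ : ℕ,
        ∀ n : ℕ, n₀ ≤ n → ∀ d : ℕ, 1 + ε ≤ (d : ℝ) → (d : ℝ) ≤ β * n →
          ∀ (lam : ℝ) (G : SimpleGraph (Fin n)),
            IsNDLGraph n d lam G → lam / d ≤ α ^ ((2 : ℝ) / α) →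
              ENNReal.ofReal (1 - γ) ≤
                percolationMeasure (Fin n) ((1 + ε) / d)
                  {ω : Fin n → Bool |
                    ∀ S : Finset (Fin n), (∀ v ∈ S, ω v = true) →
                      α * n / d ≤ (S.card : ℝ) → (S.card : ℝ) ≤ (n : ℝ) / (3 * d) →
                        ¬ ((extNbhd G (S : Set (Fin n))).ncard : ℝ) <
                            (1 - α) * (d * S.card - d ^ 2 * (S.card : ℝ) ^ 2 / (2 * n))} := by
  classical
  refine ⟨1 / 4, by norm_num, fun ε hε0 hε1 α hα0 hα γ hγ => ?_⟩
  have hα1 : α < 1 / 65536 :=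
    hα.trans ((pow_lt_pow_left₀ hε1 hε0.le (by norm_num)).trans_eq (by norm_num))
  obtain ⟨K, hK⟩ := exists_pow_lt_of_lt_one (half_pos hγ) (by norm_num : (1 / 2 : ℝ) < 1)
  refine ⟨min (1 / 2) (α / (K + 1)), by positivity, 0, ?_⟩
  intro n _ d hd1 hdβ lam G hG hlam
  let := Classical.decRel G.Adj
  obtain ⟨hreg, i₀, -, hev⟩ := hG
  have hd' : (0 : ℝ) < d := by linarith
  have hd : 0 < d := by exact_mod_cast hd'
  have hn' : (0 : ℝ) < n := by exact_mod_cast Fin.pos i₀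
  have hdn : 2 * d ≤ n := by
    have : (d : ℝ) ≤ 1 / 2 * n := hdβ.trans (by gcongr; exact min_le_left _ _)
    have : (2 * d : ℝ) ≤ n := by linarith
    exact_mod_cast this
  have hKn : (K : ℝ) ≤ α * n / d := by
    have : (d : ℝ) ≤ α / (K + 1) * n := hdβ.trans (by gcongr; exact min_le_right _ _)
    rw [div_mul_eq_mul_div, le_div_iff₀ (by positivity)] at this
    rw [le_div_iff₀ hd']
    linarith
  have hev' : ∀ i ≠ i₀, |G.adjHermitian.eigenvalues i| ≤ α ^ (2 / α) * d := fun i hi =>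
    (hev i hi).trans ((div_le_iff₀ hd').1 hlam)
  have hp0 : 0 ≤ (1 + ε) / d := by positivity
  have hp1 : (1 + ε) / d ≤ 1 := (div_le_one hd').2 hd1
  set p := (1 + ε) / d with hp
  have := isProbabilityMeasure_bernoulliMeasure hp0 hp1
  have : MeasureTheory.IsProbabilityMeasure (percolationMeasure (Fin n) p) := by
    unfold percolationMeasure; infer_instance
  set E := {ω : Fin n → Bool | ∀ S : Finset (Fin n), (∀ v ∈ S, ω v = true) →
    α * n / d ≤ (S.card : ℝ) → (S.card : ℝ) ≤ (n : ℝ) / (3 * d) →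
      ¬ ((extNbhd G (S : Set (Fin n))).ncard : ℝ) <
        (1 - α) * (d * S.card - d ^ 2 * (S.card : ℝ) ^ 2 / (2 * n))}
  have hsub : Eᶜ ⊆ ⋃ S ∈ univ.filter (HasSmallNbhd G d α),
      {ω : Fin n → Bool | ∀ v ∈ S, ω v = true} := by
    intro ω hω
    simp only [E, Set.mem_compl_iff, Set.mem_ofPred_eq, not_forall, not_not] at hω
    obtain ⟨S, h1, h2, h3, h4⟩ := hω
    exact Set.mem_biUnion (mem_coe.2 (mem_filter.2 ⟨mem_univ S, h2, h3, h4⟩)) h1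
  have hsum : ∑ S ∈ univ.filter (HasSmallNbhd G d α), p ^ S.card ≤ γ := by
    have hmaps : ∀ S ∈ univ.filter (HasSmallNbhd G d α),
        S.card ∈ (range (n + 1)).filter (K ≤ ·) := by
      intro S hS
      have h1 : S.card ≤ n := by simpa using card_le_univ S
      have h2 : (K : ℝ) ≤ S.card := hKn.trans (mem_filter.1 hS).2.1
      exact mem_filter.2 ⟨mem_range.2 (by omega), by exact_mod_cast h2⟩
    rw [← sum_fiberwise_of_maps_to hmaps]
    refine (sum_le_sum fun m _ => ?_).trans
      ((sum_half_pow_filter_le K (n + 1)).trans (by linarith))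
    refine le_trans (le_of_eq ?_)
      (card_hasSmallNbhd_mul_pow_le hreg G.adjHermitian hd hdn hα0 hα1 hε0 hε1 hev' m)
    rw [sum_congr rfl fun S hS => by rw [(mem_filter.1 hS).2], sum_const, nsmul_eq_mul]
    congr 3
    ext S
    simp [and_comm]
  have hcompl : percolationMeasure (Fin n) p Eᶜ ≤ ENNReal.ofReal γ := by
    refine (MeasureTheory.measure_mono hsub).trans
      ((MeasureTheory.measure_biUnion_finset_le _ _).trans ?_)
    simp only [percolationMeasure_forall_mem hp0 hp1]
    rw [← ENNReal.ofReal_sum_of_nonneg fun S _ => by positivity]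
    exact ENNReal.ofReal_le_ofReal hsum
  have htot : 1 ≤ percolationMeasure (Fin n) p E + ENNReal.ofReal γ := by
    calc (1 : ENNReal) = percolationMeasure (Fin n) p (E ∪ Eᶜ) := by
          rw [Set.union_compl_self, MeasureTheory.measure_univ]
      _ ≤ _ := (MeasureTheory.measure_union_le _ _).trans (by gcongr)
  rw [ENNReal.ofReal_sub _ hγ.le, ENNReal.ofReal_one]
  exact tsub_le_iff_right.2 htot
end
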